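/- arXiv:2102.06773 — 2 statements merged into one kernel-verified Lean document; each statement's English description precedes it below -/
import Mathlib

section
/- A graph G on 8 vertices maximizes the number of induced copies of C5 among all graphs on 8 vertices if and only if G is a balanced blow-up of C5, the Möbius ladder M8, or the complement of M8; in particular, the maximum number of induced copies of C5 among 8-vertex graphs equals 8. -/
/-- The 5-cycle on `Fin 5`. -/
def C5 : SimpleGraph (Fin 5) := SimpleGraph.fromRel (fun i j => j = i + 1)

/-- The Möbius ladder on `Fin 8` (= ℤ/8ℤ): `i ~ j` iff `i - j ∈ {±1, 4}`. -/
def M8 : SimpleGraph (Fin 8) := SimpleGraph.fromRel (fun i j => j = i + 1 ∨ j = i + 4)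

/-- The number of induced copies of `H` in `G`. -/
noncomputable def inducedCopies {U V : Type} [Fintype U] [Fintype V]
    (H : SimpleGraph U) (G : SimpleGraph V) : ℕ :=
  Nat.card {s : Finset V // s.card = Fintype.card U ∧
    Nonempty (G.induce (s : Set V) ≃g H)}

/-- The number of induced copies of the 5-cycle in `G`. -/
noncomputable def c5 {V : Type} [Fintype V] (G : SimpleGraph V) : ℕ :=
  inducedCopies C5 G

/-- `G` is a balanced blow-up of `H`. -/
def IsBalancedBlowupOf {U W : Type} [Fintype U] [Fintype W]
    (H : SimpleGraph U) (G : SimpleGraph W) : Prop :=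
  Fintype.card W < Fintype.card U ∨
    ∃ P : W → U, Function.Surjective P ∧
      (∀ w w' : W, P w ≠ P w' → (G.Adj w w' ↔ H.Adj (P w) (P w'))) ∧
      ∀ u v : U, Nat.card {w : W // P w = u} ≤ Nat.card {w : W // P w = v} + 1

structure R5 where
  r0 : Bool
  r1 : Bool
  r2 : Bool
  r3 : Bool
  r4 : Bool

/-- `If b t f` selects `t` or `f` with a single recursor (cheap for the kernel). -/
local notation "If[" b "," t "," f "]" => @Bool.rec (fun _ => _) f t b

noncomputable def bn (b : Bool) : Nat := @Bool.rec (fun _ => Nat) (nat_lit 0) (nat_lit 1) b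

noncomputable def isC5aux (pq rs pr qs ps qr : Bool) : Bool :=
  If[pq, false, If[rs,
    If[pr, If[qs, If[ps, false, If[qr, false, true]], false],
      If[qs, false, If[ps, qr, false]]], false]]

/-- 2-regularity of a graph on five vertices, as a decision tree. -/
noncomputable def isC5 (x01 x02 x03 x04 x12 x13 x14 x23 x24 x34 : Bool) : Bool :=
  If[x01,
    If[x02, If[x03, false, If[x04, false, isC5aux x12 x34 x13 x24 x14 x23]],
      If[x03, If[x04, false, isC5aux x13 x24 x12 x34 x14 x23],
        If[x04, isC5aux x14 x23 x12 x34 x13 x24, false]]],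
    If[x02, If[x03, If[x04, false, isC5aux x23 x14 x12 x34 x24 x13],
        If[x04, isC5aux x24 x13 x12 x34 x23 x14, false]],
      If[x03, If[x04, isC5aux x34 x12 x13 x24 x23 x14, false], false]]]

noncomputable def cntF (a : R5) : Nat :=
  Nat.add (bn (isC5 true false false a.r0 true false a.r1 true a.r2 a.r3)) <|
  Nat.add (bn (isC5 true false true a.r0 true false a.r1 false a.r2 a.r4)) <|
  Nat.add (bn (isC5 true false true a.r0 false false a.r1 true a.r3 a.r4)) <|
  Nat.add (bn (isC5 false false true a.r0 true false a.r2 true a.r3 a.r4)) <|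
  bn (isC5 true false false a.r1 true false a.r2 true a.r3 a.r4)

noncomputable def cntG (a b : R5) (x : Bool) : Nat :=
  Nat.add (bn (isC5 true false a.r0 b.r0 true a.r1 b.r1 a.r2 b.r2 x)) <|
  Nat.add (bn (isC5 true false a.r0 b.r0 false a.r1 b.r1 a.r3 b.r3 x)) <|
  Nat.add (bn (isC5 true true a.r0 b.r0 false a.r1 b.r1 a.r4 b.r4 x)) <|
  Nat.add (bn (isC5 false false a.r0 b.r0 true a.r2 b.r2 a.r3 b.r3 x)) <|
  Nat.add (bn (isC5 false true a.r0 b.r0 false a.r2 b.r2 a.r4 b.r4 x)) <|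
  Nat.add (bn (isC5 false true a.r0 b.r0 true a.r3 b.r3 a.r4 b.r4 x)) <|
  Nat.add (bn (isC5 true false a.r1 b.r1 true a.r2 b.r2 a.r3 b.r3 x)) <|
  Nat.add (bn (isC5 true false a.r1 b.r1 false a.r2 b.r2 a.r4 b.r4 x)) <|
  Nat.add (bn (isC5 false false a.r1 b.r1 true a.r3 b.r3 a.r4 b.r4 x)) <|
  bn (isC5 true false a.r2 b.r2 true a.r3 b.r3 a.r4 b.r4 x)

noncomputable def cntH (a b c : R5) (x y z : Bool) : Nat :=
  Nat.add (bn (isC5 true a.r0 b.r0 c.r0 a.r1 b.r1 c.r1 x y z)) <|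
  Nat.add (bn (isC5 false a.r0 b.r0 c.r0 a.r2 b.r2 c.r2 x y z)) <|
  Nat.add (bn (isC5 false a.r0 b.r0 c.r0 a.r3 b.r3 c.r3 x y z)) <|
  Nat.add (bn (isC5 true a.r0 b.r0 c.r0 a.r4 b.r4 c.r4 x y z)) <|
  Nat.add (bn (isC5 true a.r1 b.r1 c.r1 a.r2 b.r2 c.r2 x y z)) <|
  Nat.add (bn (isC5 false a.r1 b.r1 c.r1 a.r3 b.r3 c.r3 x y z)) <|
  Nat.add (bn (isC5 false a.r1 b.r1 c.r1 a.r4 b.r4 c.r4 x y z)) <|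
  Nat.add (bn (isC5 true a.r2 b.r2 c.r2 a.r3 b.r3 c.r3 x y z)) <|
  Nat.add (bn (isC5 false a.r2 b.r2 c.r2 a.r4 b.r4 c.r4 x y z)) <|
  bn (isC5 true a.r3 b.r3 c.r3 a.r4 b.r4 c.r4 x y z)

def L21 : List (Fin 8 × Fin 8 × Fin 8 × Fin 8 × Fin 8) := [(0, 1, 2, 3, 4), (0, 1, 2, 3, 5), (0, 1, 2, 3, 6), (0, 1, 2, 4, 5), (0, 1, 2, 4, 6),
  (0, 1, 2, 5, 6), (0, 1, 3, 4, 5), (0, 1, 3, 4, 6), (0, 1, 3, 5, 6), (0, 1, 4, 5, 6),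
  (0, 2, 3, 4, 5), (0, 2, 3, 4, 6), (0, 2, 3, 5, 6), (0, 2, 4, 5, 6), (0, 3, 4, 5, 6),
  (1, 2, 3, 4, 5), (1, 2, 3, 4, 6), (1, 2, 3, 5, 6), (1, 2, 4, 5, 6), (1, 3, 4, 5, 6),
  (2, 3, 4, 5, 6)]

def L35 : List (Fin 8 × Fin 8 × Fin 8 × Fin 8 × Fin 8) := [(0, 1, 2, 3, 7), (0, 1, 2, 4, 7), (0, 1, 2, 5, 7), (0, 1, 2, 6, 7), (0, 1, 3, 4, 7),
  (0, 1, 3, 5, 7), (0, 1, 3, 6, 7), (0, 1, 4, 5, 7), (0, 1, 4, 6, 7), (0, 1, 5, 6, 7),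
  (0, 2, 3, 4, 7), (0, 2, 3, 5, 7), (0, 2, 3, 6, 7), (0, 2, 4, 5, 7), (0, 2, 4, 6, 7),
  (0, 2, 5, 6, 7), (0, 3, 4, 5, 7), (0, 3, 4, 6, 7), (0, 3, 5, 6, 7), (0, 4, 5, 6, 7),
  (1, 2, 3, 4, 7), (1, 2, 3, 5, 7), (1, 2, 3, 6, 7), (1, 2, 4, 5, 7), (1, 2, 4, 6, 7),
  (1, 2, 5, 6, 7), (1, 3, 4, 5, 7), (1, 3, 4, 6, 7), (1, 3, 5, 6, 7), (1, 4, 5, 6, 7),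
  (2, 3, 4, 5, 7), (2, 3, 4, 6, 7), (2, 3, 5, 6, 7), (2, 4, 5, 6, 7), (3, 4, 5, 6, 7)]

def mobMaps : List (Fin 8 → Fin 8) := [![0, 1, 2, 3, 4, 5, 6, 7], ![0, 1, 2, 3, 4, 5, 7, 6], ![0, 1, 2, 3, 4, 6, 5, 7],
  ![0, 1, 2, 3, 4, 6, 7, 5], ![0, 1, 2, 3, 4, 7, 5, 6], ![0, 1, 2, 3, 4, 7, 6, 5],
  ![0, 1, 2, 3, 7, 4, 5, 6], ![0, 1, 2, 3, 7, 4, 6, 5], ![0, 1, 2, 3, 7, 5, 4, 6],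
  ![0, 1, 2, 3, 7, 5, 6, 4], ![0, 1, 2, 3, 7, 6, 4, 5], ![0, 1, 2, 3, 7, 6, 5, 4],
  ![0, 1, 2, 6, 7, 3, 4, 5], ![0, 1, 2, 6, 7, 3, 5, 4], ![0, 1, 2, 6, 7, 4, 3, 5],
  ![0, 1, 2, 6, 7, 4, 5, 3], ![0, 1, 2, 6, 7, 5, 3, 4], ![0, 1, 2, 6, 7, 5, 4, 3],
  ![0, 1, 5, 6, 7, 2, 3, 4], ![0, 1, 5, 6, 7, 2, 4, 3], ![0, 1, 5, 6, 7, 3, 2, 4],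
  ![0, 1, 5, 6, 7, 3, 4, 2], ![0, 1, 5, 6, 7, 4, 2, 3], ![0, 1, 5, 6, 7, 4, 3, 2],
  ![0, 4, 3, 2, 1, 5, 6, 7], ![0, 4, 3, 2, 1, 5, 7, 6], ![0, 4, 3, 2, 1, 6, 5, 7],
  ![0, 4, 3, 2, 1, 6, 7, 5], ![0, 4, 3, 2, 1, 7, 5, 6], ![0, 4, 3, 2, 1, 7, 6, 5]]

def mobCMaps : List (Fin 8 → Fin 8) := [![0, 2, 4, 1, 3, 5, 6, 7], ![0, 2, 4, 1, 3, 5, 7, 6], ![0, 2, 4, 1, 3, 6, 5, 7],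
  ![0, 2, 4, 1, 3, 6, 7, 5], ![0, 2, 4, 1, 3, 7, 5, 6], ![0, 2, 4, 1, 3, 7, 6, 5],
  ![0, 2, 7, 1, 3, 4, 5, 6], ![0, 2, 7, 1, 3, 4, 6, 5], ![0, 2, 7, 1, 3, 5, 4, 6],
  ![0, 2, 7, 1, 3, 5, 6, 4], ![0, 2, 7, 1, 3, 6, 4, 5], ![0, 2, 7, 1, 3, 6, 5, 4],
  ![0, 2, 7, 1, 6, 3, 4, 5], ![0, 2, 7, 1, 6, 3, 5, 4], ![0, 2, 7, 1, 6, 4, 3, 5],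
  ![0, 2, 7, 1, 6, 4, 5, 3], ![0, 2, 7, 1, 6, 5, 3, 4], ![0, 2, 7, 1, 6, 5, 4, 3],
  ![0, 3, 1, 4, 2, 5, 6, 7], ![0, 3, 1, 4, 2, 5, 7, 6], ![0, 3, 1, 4, 2, 6, 5, 7],
  ![0, 3, 1, 4, 2, 6, 7, 5], ![0, 3, 1, 4, 2, 7, 5, 6], ![0, 3, 1, 4, 2, 7, 6, 5],
  ![0, 3, 1, 7, 2, 4, 5, 6], ![0, 3, 1, 7, 2, 4, 6, 5], ![0, 3, 1, 7, 2, 5, 4, 6],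
  ![0, 3, 1, 7, 2, 5, 6, 4], ![0, 3, 1, 7, 2, 6, 4, 5], ![0, 3, 1, 7, 2, 6, 5, 4]]

noncomputable def allB (f : Bool → Bool) : Bool := If[f false, f true, false]

noncomputable def allR (f : R5 → Bool) : Bool :=
  allB fun r0 => allB fun r1 => allB fun r2 => allB fun r3 => allB fun r4 => f ⟨r0, r1, r2, r3, r4⟩

def R5.get (a : R5) (i : Fin 5) : Bool :=
  match i with
  | 0 => a.r0
  | 1 => a.r1
  | 2 => a.r2
  | 3 => a.r3
  | 4 => a.r4

def twin (a : R5) (p : Fin 5) : Bool :=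
  match p with
  | 0 => a.r1 && a.r4 && !a.r2 && !a.r3
  | 1 => a.r0 && a.r2 && !a.r3 && !a.r4
  | 2 => a.r1 && a.r3 && !a.r0 && !a.r4
  | 3 => a.r2 && a.r4 && !a.r0 && !a.r1
  | 4 => a.r0 && a.r3 && !a.r1 && !a.r2

def cadj (i j : Fin 5) : Bool :=
  match i, j with
  | 0, 1 => true | 1, 0 => true
  | 1, 2 => true | 2, 1 => true
  | 2, 3 => true | 3, 2 => true
  | 3, 4 => true | 4, 3 => true
  | 4, 0 => true | 0, 4 => true
  | _, _ => false

def madj (i j : Fin 8) : Bool := decide (j = i + 1 ∨ j = i + 4 ∨ i = j + 1 ∨ i = j + 4)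
def mcadj (i j : Fin 8) : Bool := !(madj i j)

def all5 : List (Fin 5) := [0, 1, 2, 3, 4]

def blowB (a b c : R5) (x y z : Bool) : Bool :=
  all5.any fun p => twin a p && all5.any fun q => twin b q && !(p == q) && (x == cadj p q) &&
    all5.any fun r => twin c r && !(p == r) && !(q == r) && (y == cadj p r) && (z == cadj q r)

/-- Does the map `p` carry the graph into the graph `A`? -/
def mapOK (A : Fin 8 → Fin 8 → Bool) (a b c : R5) (x y z : Bool) (p : Fin 8 → Fin 8) : Bool :=
  (x == A (p 5) (p 6)) && (y == A (p 5) (p 7)) && (z == A (p 6) (p 7)) &&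
  (a.r0 == A (p 0) (p 5)) && (a.r1 == A (p 1) (p 5)) && (a.r2 == A (p 2) (p 5)) &&
  (a.r3 == A (p 3) (p 5)) && (a.r4 == A (p 4) (p 5)) &&
  (b.r0 == A (p 0) (p 6)) && (b.r1 == A (p 1) (p 6)) && (b.r2 == A (p 2) (p 6)) &&
  (b.r3 == A (p 3) (p 6)) && (b.r4 == A (p 4) (p 6)) &&
  (c.r0 == A (p 0) (p 7)) && (c.r1 == A (p 1) (p 7)) && (c.r2 == A (p 2) (p 7)) &&
  (c.r3 == A (p 3) (p 7)) && (c.r4 == A (p 4) (p 7))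

def goodB (a b c : R5) (x y z : Bool) : Bool :=
  bif blowB a b c x y z then true else
  bif mobMaps.any (mapOK madj a b c x y z) then true else
  mobCMaps.any (mapOK mcadj a b c x y z)

noncomputable def stepB (a b c : R5) (x y z : Bool) (n : Nat) : Bool :=
  If[Nat.ble (nat_lit 8) n, Nat.ble n (nat_lit 8) && goodB a b c x y z, true]

noncomputable def cnt7 (a b : R5) (x : Bool) : Nat :=
  Nat.add (nat_lit 1) <| Nat.add (cntF a) <| Nat.add (cntF b) (cntG a b x)

noncomputable def cnt8 (a b c : R5) (x y z : Bool) : Nat :=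
  Nat.add (cnt7 a b x) <| Nat.add (cntF c) <| Nat.add (cntG a c y) <|
    Nat.add (cntG b c z) (cntH a b c x y z)

set_option maxHeartbeats 4000000 in
theorem big_check (r0 r1 r2 r3 : Bool) : (allB fun r4 => allR fun b => allB fun x =>
    If[Nat.ble (nat_lit 3) (cnt7 ⟨r0, r1, r2, r3, r4⟩ b x),
    (allR fun c => allB fun y => allB fun z => stepB ⟨r0, r1, r2, r3, r4⟩ b c x y z
      (cnt8 ⟨r0, r1, r2, r3, r4⟩ b c x y z)), true]) = true := by
  cases r0 <;> cases r1 <;> cases r2 <;> cases r3 <;> decide +kernel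

open Classical in
/-- Boolean adjacency. -/
noncomputable def adjB {V : Type} (G : SimpleGraph V) (i j : V) : Bool := decide (G.Adj i j)

theorem adjB_iff {V : Type} (G : SimpleGraph V) (i j : V) : adjB G i j = true ↔ G.Adj i j := by
  simp [adjB]

theorem adjB_comm {V : Type} (G : SimpleGraph V) (i j : V) : adjB G i j = adjB G j i := by
  simp [adjB, G.adj_comm]

theorem adjB_self {V : Type} (G : SimpleGraph V) (i : V) : adjB G i i = false := by
  simp [adjB]

theorem cadj_iff : ∀ i j : Fin 5, C5.Adj i j ↔ cadj i j = true := by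
  unfold C5
  simp only [SimpleGraph.fromRel_adj]
  decide

theorem madj_iff : ∀ i j : Fin 8, M8.Adj i j ↔ madj i j = true := by
  unfold M8
  simp only [SimpleGraph.fromRel_adj]
  decide

theorem mcadj_iff : ∀ i j : Fin 8, i ≠ j → (M8ᶜ.Adj i j ↔ mcadj i j = true) := by
  intro i j h
  rw [SimpleGraph.compl_adj, madj_iff, mcadj]
  simp [h]

theorem perm_isC5 : ∀ s : Equiv.Perm (Fin 5), isC5 (cadj (s 0) (s 1)) (cadj (s 0) (s 2))
    (cadj (s 0) (s 3)) (cadj (s 0) (s 4)) (cadj (s 1) (s 2)) (cadj (s 1) (s 3))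
    (cadj (s 1) (s 4)) (cadj (s 2) (s 3)) (cadj (s 2) (s 4)) (cadj (s 3) (s 4)) = true := by
  decide +kernel

set_option synthInstance.maxHeartbeats 400000 in
set_option synthInstance.maxSize 4000 in
theorem isC5_perm : ∀ a b c d e f g h i j : Bool, isC5 a b c d e f g h i j = true →
    ∃ s : Equiv.Perm (Fin 5), (cadj (s 0) (s 1)) = a ∧ (cadj (s 0) (s 2)) = b ∧
    (cadj (s 0) (s 3)) = c ∧ (cadj (s 0) (s 4)) = d ∧ (cadj (s 1) (s 2)) = e ∧
    (cadj (s 1) (s 3)) = f ∧ (cadj (s 1) (s 4)) = g ∧ (cadj (s 2) (s 3)) = h ∧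
    (cadj (s 2) (s 4)) = i ∧ (cadj (s 3) (s 4)) = j := by
  decide +kernel

theorem cadj_comm : ∀ i j, cadj i j = cadj j i := by decide
theorem cadj_self : ∀ i, cadj i i = false := by decide

theorem iso_C5_iff (H : SimpleGraph (Fin 5)) : Nonempty (H ≃g C5) ↔
    isC5 (adjB H 0 1) (adjB H 0 2) (adjB H 0 3) (adjB H 0 4) (adjB H 1 2) (adjB H 1 3)
      (adjB H 1 4) (adjB H 2 3) (adjB H 2 4) (adjB H 3 4) = true := by
  constructor
  · rintro ⟨e⟩
    have h : ∀ i j, adjB H i j = cadj (e.toEquiv i) (e.toEquiv j) := by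
      intro i j
      rw [Bool.eq_iff_iff, adjB_iff, ← cadj_iff]
      exact e.map_rel_iff.symm
    simp only [h]
    exact perm_isC5 e.toEquiv
  · intro h
    obtain ⟨s, h01, h02, h03, h04, h12, h13, h14, h23, h24, h34⟩ :=
      isC5_perm _ _ _ _ _ _ _ _ _ _ h
    have key : ∀ i j, cadj (s i) (s j) = adjB H i j := by
      intro i j
      have hlt : ∀ i j : Fin 5, i < j → cadj (s i) (s j) = adjB H i j := by
        intro i j hij
        fin_cases i <;> fin_cases j <;> first | assumption | exact absurd hij (by decide)
      rcases lt_trichotomy i j with hij | rfl | hij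
      · exact hlt i j hij
      · rw [cadj_self, adjB_self]
      · rw [cadj_comm, adjB_comm, hlt j i hij]
    exact ⟨⟨s, by intro i j; rw [cadj_iff, key, adjB_iff]⟩⟩

abbrev T5 := Fin 8 × Fin 8 × Fin 8 × Fin 8 × Fin 8

def tset (t : T5) : Finset (Fin 8) := {t.1, t.2.1, t.2.2.1, t.2.2.2.1, t.2.2.2.2}

def tfun (t : T5) : Fin 5 → Fin 8 := ![t.1, t.2.1, t.2.2.1, t.2.2.2.1, t.2.2.2.2]

noncomputable def tst (A : Fin 8 → Fin 8 → Bool) (t : T5) : Bool :=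
  isC5 (A t.1 t.2.1) (A t.1 t.2.2.1) (A t.1 t.2.2.2.1) (A t.1 t.2.2.2.2)
    (A t.2.1 t.2.2.1) (A t.2.1 t.2.2.2.1) (A t.2.1 t.2.2.2.2)
    (A t.2.2.1 t.2.2.2.1) (A t.2.2.1 t.2.2.2.2) (A t.2.2.2.1 t.2.2.2.2)

/-- being an induced 5-cycle -/
def isCyc (G : SimpleGraph (Fin 8)) (s : Finset (Fin 8)) : Prop :=
  Nonempty (G.induce (s : Set (Fin 8)) ≃g C5)

noncomputable def comapIso {V W : Type} (G : SimpleGraph V) (f : W → V)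
    (hf : Function.Injective f) : G.comap f ≃g G.induce (Set.range f) where
  toEquiv := Equiv.ofInjective f hf
  map_rel_iff' := by intro a b; simp

theorem cyc_range_iff (G : SimpleGraph (Fin 8)) (s : Finset (Fin 8)) (f : Fin 5 → Fin 8)
    (hf : Function.Injective f) (hs : (s : Set (Fin 8)) = Set.range f) :
    isCyc G s ↔ Nonempty (G.comap f ≃g C5) := by
  unfold isCyc
  rw [hs]
  constructor
  · rintro ⟨e⟩
    exact ⟨(comapIso G f hf).trans e⟩
  · rintro ⟨e⟩
    exact ⟨(comapIso G f hf).symm.trans e⟩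

theorem cyc_iff_tst (G : SimpleGraph (Fin 8)) (t : T5) (ht : Function.Injective (tfun t)) :
    isCyc G (tset t) ↔ tst (adjB G) t = true := by
  rw [cyc_range_iff G (tset t) (tfun t) ht, iso_C5_iff]
  · rfl
  · ext x
    simp only [tset, tfun, Finset.coe_insert, Finset.coe_singleton, Set.mem_insert_iff,
      Set.mem_singleton_iff, Set.mem_range, Fin.exists_fin_succ]
    simp [eq_comm]

open Classical in
theorem count_list (G : SimpleGraph (Fin 8)) (L : List T5) (T : Finset (Finset (Fin 8)))
    (hT : T = (L.map tset).toFinset) (hn : (L.map tset).Nodup)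
    (hi : ∀ t ∈ L, Function.Injective (tfun t)) :
    (T.filter (isCyc G)).card = (L.map (fun t => bn (tst (adjB G) t))).sum := by
  rw [Finset.card_filter, hT, List.sum_toFinset _ hn, List.map_map]
  congr 1
  apply List.map_congr_left
  intro t ht
  have := cyc_iff_tst G t (hi t ht)
  simp only [Function.comp]
  cases h : tst (adjB G) t
  · rw [if_neg (by rw [this, h]; simp)]; rfl
  · rw [if_pos (by rw [this, h])]; rfl

open Classical in
noncomputable def fam (G : SimpleGraph (Fin 8)) : Finset (Finset (Fin 8)) :=
  (Finset.powersetCard 5 Finset.univ).filter (isCyc G)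

theorem c5_eq (G : SimpleGraph (Fin 8)) : c5 G = (fam G).card := by
  classical
  unfold c5 inducedCopies
  rw [Nat.card_eq_fintype_card]
  rw [Fintype.card_subtype]
  congr 1
  ext s
  simp [fam, isCyc, Finset.mem_powersetCard]

theorem list_spec (L : List T5) (n : Finset (Fin 8))
    (hi : ∀ t ∈ L, Function.Injective (tfun t))
    (hs : ∀ t ∈ L, tset t ⊆ n)
    (hm : (L.map (fun t => Nat.pow 2 t.1.val + Nat.pow 2 t.2.1.val + Nat.pow 2 t.2.2.1.val +
      Nat.pow 2 t.2.2.2.1.val + Nat.pow 2 t.2.2.2.2.val)).Nodup) (hl : L.length = n.card.choose 5) :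
    Finset.powersetCard 5 n = (L.map tset).toFinset ∧ (L.map tset).Nodup := by
  have himg : ∀ t : T5, tset t = Finset.univ.image (tfun t) := by
    intro t
    ext x
    simp only [tset, tfun, Finset.mem_insert, Finset.mem_singleton, Finset.mem_image,
      Finset.mem_univ, true_and, Fin.exists_fin_succ]
    simp [eq_comm]
  have hnd : (L.map tset).Nodup := by
    apply List.Nodup.of_map (fun s : Finset (Fin 8) => ∑ i ∈ s, Nat.pow 2 i.val)
    rw [List.map_map]
    convert hm using 1
    apply List.map_congr_left
    intro t ht
    simp only [Function.comp]
    rw [himg, Finset.sum_image (fun a _ b _ h => hi t ht h)]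
    simp [Fin.sum_univ_succ, tfun]
    ring
  refine ⟨?_, hnd⟩
  symm
  apply Finset.eq_of_subset_of_card_le
  · intro s hs'
    simp only [List.mem_toFinset, List.mem_map] at hs'
    obtain ⟨t, ht, rfl⟩ := hs'
    rw [Finset.mem_powersetCard]
    refine ⟨hs t ht, ?_⟩
    rw [himg, Finset.card_image_of_injective _ (hi t ht)]
    simp
  · rw [List.toFinset_card_of_nodup hnd, Finset.card_powersetCard, List.length_map, hl]

theorem L56_inj : ∀ t ∈ L21 ++ L35, Function.Injective (tfun t) := by
  have h : (L21 ++ L35).all (fun t => decide (Function.Injective (tfun t))) = true := by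
    decide +kernel
  intro t ht
  exact of_decide_eq_true (List.all_eq_true.mp h t ht)

theorem L21_inj : ∀ t ∈ L21, Function.Injective (tfun t) := fun t ht => L56_inj t (by simp [ht])

theorem L56_spec : (Finset.powersetCard 5 (Finset.univ : Finset (Fin 8)) =
    ((L21 ++ L35).map tset).toFinset) ∧ ((L21 ++ L35).map tset).Nodup :=
  list_spec _ _ L56_inj (fun _ _ => Finset.subset_univ _) (by decide +kernel) (by decide +kernel)

theorem L21_spec : ((Finset.powersetCard 5 (Finset.univ : Finset (Fin 8))).filter (7 ∉ ·) =
    (L21.map tset).toFinset) ∧ (L21.map tset).Nodup := by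
  have h0 : L21.all (fun t => decide (tset t ⊆ Finset.univ.erase 7)) = true := by
    decide +kernel
  have h := list_spec L21 (Finset.univ.erase 7) L21_inj
    (fun t ht => of_decide_eq_true (List.all_eq_true.mp h0 t ht)) (by decide +kernel)
    (by decide +kernel)
  refine ⟨?_, h.2⟩
  rw [← h.1]
  ext s
  simp [Finset.mem_powersetCard, Finset.subset_erase, and_comm]

theorem fam_card (G : SimpleGraph (Fin 8)) :
    (fam G).card = ((L21 ++ L35).map (fun t => bn (tst (adjB G) t))).sum :=
  count_list G _ _ L56_spec.1 L56_spec.2 L56_inj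

theorem fam_card7 (G : SimpleGraph (Fin 8)) :
    ((fam G).filter (7 ∉ ·)).card = (L21.map (fun t => bn (tst (adjB G) t))).sum := by
  classical
  rw [← count_list G _ _ L21_spec.1 L21_spec.2 L21_inj, fam, Finset.filter_comm]

/-- the row of `v` against the standard cycle -/
noncomputable def rowOf (G : SimpleGraph (Fin 8)) (v : Fin 8) : R5 :=
  ⟨adjB G 0 v, adjB G 1 v, adjB G 2 v, adjB G 3 v, adjB G 4 v⟩

def Std (G : SimpleGraph (Fin 8)) : Prop :=
  ∀ i j : Fin 5, adjB G (i.castLE (by decide)) (j.castLE (by decide)) = cadj i j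

theorem std_card (G : SimpleGraph (Fin 8)) (h : Std G) :
    ((fam G).filter (7 ∉ ·)).card = cnt7 (rowOf G 5) (rowOf G 6) (adjB G 5 6) ∧
    (fam G).card = cnt8 (rowOf G 5) (rowOf G 6) (rowOf G 7)
      (adjB G 5 6) (adjB G 5 7) (adjB G 6 7) := by
  have h01 : adjB G 0 1 = true := h 0 1
  have h02 : adjB G 0 2 = false := h 0 2
  have h03 : adjB G 0 3 = false := h 0 3
  have h04 : adjB G 0 4 = true := h 0 4
  have h12 : adjB G 1 2 = true := h 1 2
  have h13 : adjB G 1 3 = false := h 1 3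
  have h14 : adjB G 1 4 = false := h 1 4
  have h23 : adjB G 2 3 = true := h 2 3
  have h24 : adjB G 2 4 = false := h 2 4
  have h34 : adjB G 3 4 = true := h 3 4
  have hone : bn (isC5 true false false true true false false true false true) = 1 := rfl
  rw [fam_card7, fam_card]
  simp only [L21, L35, List.cons_append, List.nil_append, List.map_cons, List.map_nil,
    List.sum_cons, List.sum_nil, tst, h01, h02, h03, h04, h12, h13, h14, h23, h24, h34, hone,
    cnt7, cnt8, cntF, cntG, cntH, rowOf, Nat.add_eq]
  constructor <;> ring

theorem allB_spec {f : Bool → Bool} (h : allB f = true) (b : Bool) : f b = true := by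
  unfold allB at h
  cases h0 : f false
  · rw [h0] at h; simp at h
  · rw [h0] at h
    cases b
    · exact h0
    · exact h

theorem allR_spec {f : R5 → Bool} (h : allR f = true) (a : R5) : f a = true := by
  obtain ⟨r0, r1, r2, r3, r4⟩ := a
  exact allB_spec (allB_spec (allB_spec (allB_spec (allB_spec h r0) r1) r2) r3) r4

theorem main_bool (a b c : R5) (x y z : Bool) (h3 : 3 ≤ cnt7 a b x)
    (h8 : 8 ≤ cnt8 a b c x y z) : cnt8 a b c x y z ≤ 8 ∧ goodB a b c x y z = true := by
  obtain ⟨r0, r1, r2, r3, r4⟩ := a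
  have h := allB_spec (allR_spec (allB_spec (big_check r0 r1 r2 r3) r4) b) x
  rw [Nat.ble_eq_true_of_le h3] at h
  have h := allB_spec (allB_spec (allR_spec h c) y) z
  unfold stepB at h
  rw [Nat.ble_eq_true_of_le h8] at h
  have h : (Nat.ble _ 8 && goodB _ b c x y z) = true := h
  rw [Bool.and_eq_true] at h
  exact ⟨Nat.le_of_ble_eq_true h.1, h.2⟩

abbrev up (i : Fin 5) : Fin 8 := i.castLE (by decide)

theorem up_cases : ∀ w : Fin 8, (∃ i : Fin 5, w = up i) ∨ w = 5 ∨ w = 6 ∨ w = 7 := by decide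

theorem pairs8 (Q : Fin 8 → Fin 8 → Prop) (hs : ∀ v w, Q v w → Q w v)
    (h : ∀ i j : Fin 5, i ≠ j → Q (up i) (up j)) (h5 : ∀ i, Q (up i) 5) (h6 : ∀ i, Q (up i) 6)
    (h7 : ∀ i, Q (up i) 7) (h56 : Q 5 6) (h57 : Q 5 7) (h67 : Q 6 7) :
    ∀ v w, v ≠ w → Q v w := by
  intro v w hvw
  rcases up_cases v with ⟨i, rfl⟩ | rfl | rfl | rfl <;>
    rcases up_cases w with ⟨j, rfl⟩ | rfl | rfl | rfl
  · exact h i j (fun e => hvw (by rw [e]))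
  · exact h5 i
  · exact h6 i
  · exact h7 i
  · exact hs _ _ (h5 j)
  · exact absurd rfl hvw
  · exact h56
  · exact h57
  · exact hs _ _ (h6 j)
  · exact hs _ _ h56
  · exact absurd rfl hvw
  · exact h67
  · exact hs _ _ (h7 j)
  · exact hs _ _ h57
  · exact hs _ _ h67
  · exact absurd rfl hvw

theorem twin_spec (a : R5) (p : Fin 5) (h : twin a p = true) :
    ∀ i, i ≠ p → a.get i = cadj i p := by
  obtain ⟨r0, r1, r2, r3, r4⟩ := a
  revert r0 r1 r2 r3 r4 p
  decide +kernel

theorem rowOf_get (G : SimpleGraph (Fin 8)) (v : Fin 8) (i : Fin 5) :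
    (rowOf G v).get i = adjB G (up i) v := by
  fin_cases i <;> rfl

def ext8 (p q r : Fin 5) : Fin 8 → Fin 5 := ![0, 1, 2, 3, 4, p, q, r]

theorem ext8_up (p q r i : Fin 5) : ext8 p q r (up i) = i := by
  fin_cases i <;> rfl

theorem ext8_bal : ∀ p q r : Fin 5, p ≠ q → p ≠ r → q ≠ r → ∀ u v : Fin 5,
    (Finset.univ.filter (fun w => ext8 p q r w = u)).card ≤
    (Finset.univ.filter (fun w => ext8 p q r w = v)).card + 1 := by
  decide +kernel

theorem blow_sound (G : SimpleGraph (Fin 8)) (hG : Std G)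
    (h : blowB (rowOf G 5) (rowOf G 6) (rowOf G 7) (adjB G 5 6) (adjB G 5 7) (adjB G 6 7) = true) :
    IsBalancedBlowupOf C5 G := by
  simp only [blowB, List.any_eq_true, Bool.and_eq_true, Bool.not_eq_true', beq_eq_false_iff_ne,
    beq_iff_eq] at h
  obtain ⟨p, -, hp, q, -, ⟨⟨hq, hpq⟩, hx⟩, r, -, ⟨⟨⟨hr, hpr⟩, hqr⟩, hy⟩, hz⟩ := h
  right
  refine ⟨ext8 p q r, fun i => ⟨up i, ext8_up p q r i⟩, ?_, ?_⟩
  · have key := pairs8 (fun w w' => ext8 p q r w ≠ ext8 p q r w' →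
      adjB G w w' = cadj (ext8 p q r w) (ext8 p q r w')) ?_ ?_ ?_ ?_ ?_ ?_ ?_ ?_
    · intro w w' hw
      have := key w w' (fun e => hw (by rw [e])) hw
      rw [← adjB_iff, this, cadj_iff]
    · intro v w hvw hne
      rw [adjB_comm, cadj_comm]
      exact hvw hne.symm
    · intro i j _ _
      rw [ext8_up, ext8_up]
      exact hG i j
    · intro i hi
      rw [ext8_up] at hi ⊢
      rw [← rowOf_get]
      exact twin_spec _ p hp i hi
    · intro i hi
      rw [ext8_up] at hi ⊢
      rw [← rowOf_get]
      exact twin_spec _ q hq i hi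
    · intro i hi
      rw [ext8_up] at hi ⊢
      rw [← rowOf_get]
      exact twin_spec _ r hr i hi
    · intro _; exact hx
    · intro _; exact hy
    · intro _; exact hz
  · intro u v
    have := ext8_bal p q r hpq hpr hqr u v
    rw [← Fintype.card_subtype, ← Fintype.card_subtype] at this
    rw [Nat.card_eq_fintype_card, Nat.card_eq_fintype_card]
    exact this

theorem map_sound (G H : SimpleGraph (Fin 8)) (hG : Std G) (A : Fin 8 → Fin 8 → Bool)
    (hA : ∀ i j, i ≠ j → (H.Adj i j ↔ A i j = true)) (hsymm : ∀ i j, A i j = A j i)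
    (L : List (Fin 8 → Fin 8))
    (hL : L.all (fun f => decide (Function.Injective f ∧
      ∀ i j : Fin 5, i ≠ j → cadj i j = A (f (up i)) (f (up j)))) = true)
    (h : L.any (mapOK A (rowOf G 5) (rowOf G 6) (rowOf G 7)
      (adjB G 5 6) (adjB G 5 7) (adjB G 6 7)) = true) : Nonempty (G ≃g H) := by
  rw [List.any_eq_true] at h
  obtain ⟨f, hf, h⟩ := h
  obtain ⟨hinj, hstd⟩ := of_decide_eq_true (List.all_eq_true.mp hL f hf)
  simp only [mapOK, Bool.and_eq_true, beq_iff_eq, and_assoc] at h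
  obtain ⟨hx, hy, hz, a0, a1, a2, a3, a4, b0, b1, b2, b3, b4, c0, c1, c2, c3, c4⟩ := h
  have key := pairs8 (fun w w' => adjB G w w' = A (f w) (f w')) ?_ ?_ ?_ ?_ ?_ hx hy hz
  · refine ⟨⟨Equiv.ofBijective f (Finite.injective_iff_bijective.mp hinj), ?_⟩⟩
    intro w w'
    simp only [Equiv.ofBijective_apply]
    by_cases e : w = w'
    · subst e; simp
    · rw [hA _ _ (fun e' => e (hinj e')), ← key w w' e, adjB_iff]
  · intro v w hvw
    rw [adjB_comm, hsymm]
    exact hvw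
  · intro i j hij
    rw [← hstd i j hij]
    exact hG i j
  · intro i
    fin_cases i
    exacts [a0, a1, a2, a3, a4]
  · intro i
    fin_cases i
    exacts [b0, b1, b2, b3, b4]
  · intro i
    fin_cases i
    exacts [c0, c1, c2, c3, c4]

def Good (G : SimpleGraph (Fin 8)) : Prop :=
  IsBalancedBlowupOf C5 G ∨ Nonempty (G ≃g M8) ∨ Nonempty (G ≃g M8ᶜ)

theorem good_sound (G : SimpleGraph (Fin 8)) (hG : Std G)
    (h : goodB (rowOf G 5) (rowOf G 6) (rowOf G 7) (adjB G 5 6) (adjB G 5 7) (adjB G 6 7) = true) :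
    Good G := by
  unfold goodB at h
  cases h1 : blowB (rowOf G 5) (rowOf G 6) (rowOf G 7) (adjB G 5 6) (adjB G 5 7) (adjB G 6 7)
  · rw [h1, cond_false] at h
    right
    cases h2 : mobMaps.any (mapOK madj (rowOf G 5) (rowOf G 6) (rowOf G 7)
      (adjB G 5 6) (adjB G 5 7) (adjB G 6 7))
    · rw [h2, cond_false] at h
      right
      exact map_sound G M8ᶜ hG mcadj mcadj_iff (by decide +kernel) mobCMaps (by decide +kernel) h
    · left
      exact map_sound G M8 hG madj (fun i j _ => madj_iff i j) (by decide +kernel) mobMaps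
        (by decide +kernel) h2
  · left
    exact blow_sound G hG h1

/-! Relabelling -/

theorem cyc_comap (G : SimpleGraph (Fin 8)) (σ : Equiv.Perm (Fin 8)) (s : Finset (Fin 8))
    (hs : s.card = 5) : isCyc (G.comap σ) s ↔ isCyc G (s.map σ.toEmbedding) := by
  have hr := s.range_orderEmbOfFin hs
  rw [cyc_range_iff (G.comap σ) s (s.orderEmbOfFin hs) (s.orderEmbOfFin hs).injective hr.symm,
    cyc_range_iff G (s.map σ.toEmbedding) (σ ∘ s.orderEmbOfFin hs)
      (σ.injective.comp (s.orderEmbOfFin hs).injective)]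
  · rw [SimpleGraph.comap_comap]
  · rw [Set.range_comp, hr]
    simp

theorem mem_fam_comap (G : SimpleGraph (Fin 8)) (σ : Equiv.Perm (Fin 8)) (s : Finset (Fin 8)) :
    s ∈ fam (G.comap σ) ↔ s.map σ.toEmbedding ∈ fam G := by
  simp only [fam, Finset.mem_filter, Finset.mem_powersetCard, Finset.subset_univ, true_and,
    Finset.card_map]
  exact and_congr_right (fun hs => cyc_comap G σ s hs)

theorem fam_comap (G : SimpleGraph (Fin 8)) (σ : Equiv.Perm (Fin 8)) :
    (fam (G.comap σ)).card = (fam G).card :=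
  Finset.card_equiv σ.finsetCongr (fun s => mem_fam_comap G σ s)

theorem fam_comap_filter (G : SimpleGraph (Fin 8)) (σ : Equiv.Perm (Fin 8)) (v : Fin 8) :
    ((fam (G.comap σ)).filter (v ∉ ·)).card = ((fam G).filter (σ v ∉ ·)).card := by
  apply Finset.card_equiv σ.finsetCongr
  intro s
  rw [Finset.mem_filter, Finset.mem_filter, mem_fam_comap]
  simp [Equiv.finsetCongr_apply]

theorem fam_iso (G H : SimpleGraph (Fin 8)) (e : G ≃g H) : (fam G).card = (fam H).card := by
  have : G = H.comap e.toEquiv := by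
    ext a b
    exact e.map_rel_iff.symm
  rw [this, fam_comap]

theorem good_comap (G : SimpleGraph (Fin 8)) (σ : Equiv.Perm (Fin 8)) (h : Good (G.comap σ)) :
    Good G := by
  have e : G ≃g G.comap σ := (SimpleGraph.Iso.comap σ G).symm
  rcases h with h | ⟨⟨h⟩⟩ | ⟨⟨h⟩⟩
  · left
    rcases h with h | ⟨P, hP, hadj, hbal⟩
    · exact absurd h (by decide)
    · right
      refine ⟨P ∘ σ.symm, hP.comp σ.symm.surjective, ?_, ?_⟩
      · intro w w' hw
        have := hadj (σ.symm w) (σ.symm w') hw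
        simpa using this
      · intro u v
        have hc : ∀ u, Nat.card {w // (P ∘ σ.symm) w = u} = Nat.card {w // P w = u} := by
          intro u
          exact Nat.card_congr (σ.symm.subtypeEquiv (fun w => Iff.rfl))
        rw [hc, hc]
        exact hbal u v
  · exact Or.inr (Or.inl ⟨e.trans h⟩)
  · exact Or.inr (Or.inr ⟨e.trans h⟩)

theorem exists_vertex (G : SimpleGraph (Fin 8)) (h : 8 ≤ (fam G).card) :
    ∃ v, 3 ≤ ((fam G).filter (v ∉ ·)).card := by
  by_contra! hlt
  have h1 : ∑ v : Fin 8, ((fam G).filter (v ∉ ·)).card ≤ ∑ _v : Fin 8, 2 :=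
    Finset.sum_le_sum (fun v _ => by have := hlt v; omega)
  have h2 : ∑ v : Fin 8, ((fam G).filter (v ∉ ·)).card = ∑ s ∈ fam G, 3 := by
    simp only [Finset.card_filter]
    rw [Finset.sum_comm]
    apply Finset.sum_congr rfl
    intro s hs
    rw [← Finset.card_filter]
    have h5 : s.card = 5 := by
      simp only [fam, Finset.mem_filter, Finset.mem_powersetCard] at hs
      exact hs.1.2
    have : (Finset.univ.filter (· ∉ s)) = sᶜ := by ext; simp
    rw [this, Finset.card_compl, h5]
    rfl
  rw [h2] at h1
  simp at h1
  omega

theorem exists_perm (f : Fin 5 → Fin 8) (v : Fin 8) (hf : Function.Injective f)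
    (hv : ∀ i, f i ≠ v) : ∃ σ : Equiv.Perm (Fin 8), (∀ i, σ (up i) = f i) ∧ σ 7 = v := by
  have h1 : Function.Injective (Fin.cons 7 up : Fin 6 → Fin 8) := by decide
  have h2 : Function.Injective (Fin.cons v f : Fin 6 → Fin 8) :=
    Fin.cons_injective_iff.mpr ⟨fun ⟨i, hi⟩ => hv i hi, hf⟩
  obtain ⟨σ, hσ⟩ := (Equiv.Perm.isMultiplyPretransitive (Fin 8) 6).exists_smul_eq ⟨_, h1⟩ ⟨_, h2⟩
  have hσ' : ∀ i : Fin 6, σ ((Fin.cons 7 up : Fin 6 → Fin 8) i) = (Fin.cons v f : Fin 6 → Fin 8) i :=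
    fun i => DFunLike.congr_fun hσ i
  exact ⟨σ, fun i => hσ' i.succ, hσ' 0⟩

theorem main_upper (G : SimpleGraph (Fin 8)) (h : 8 ≤ (fam G).card) :
    (fam G).card ≤ 8 ∧ Good G := by
  obtain ⟨v, hv⟩ := exists_vertex G h
  have hne : ((fam G).filter (v ∉ ·)).Nonempty := by
    rw [← Finset.card_pos]; omega
  obtain ⟨s, hs⟩ := hne
  simp only [fam, Finset.mem_filter, isCyc] at hs
  obtain ⟨⟨-, ⟨e⟩⟩, hvs⟩ := hs
  obtain ⟨σ, hσ, hσ7⟩ := exists_perm (fun i => (e.symm i).1) v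
    (fun i j hij => e.symm.injective (Subtype.ext hij))
    (fun i hi => hvs (by rw [← hi]; exact (e.symm i).2))
  have hstd : Std (G.comap σ) := by
    intro i j
    rw [Bool.eq_iff_iff, adjB_iff, ← cadj_iff, SimpleGraph.comap_adj]
    have hi : σ (i.castLE (by decide)) = (e.symm i).1 := hσ i
    have hj : σ (j.castLE (by decide)) = (e.symm j).1 := hσ j
    rw [hi, hj]
    exact e.symm.map_rel_iff
  obtain ⟨k7, k8⟩ := std_card _ hstd
  rw [fam_comap_filter, hσ7] at k7
  rw [fam_comap] at k8
  rw [k7] at hv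
  rw [k8] at h ⊢
  obtain ⟨m1, m2⟩ := main_bool _ _ _ _ _ _ hv h
  exact ⟨m1, good_comap G σ (good_sound _ hstd m2)⟩

theorem fam_M8 : (fam M8).card = 8 := by
  rw [fam_card]
  have : adjB M8 = madj := by
    funext i j
    rw [Bool.eq_iff_iff, adjB_iff, madj_iff]
  rw [this]
  decide +kernel

theorem fam_M8c : (fam M8ᶜ).card = 8 := by
  rw [fam_card]
  have : adjB M8ᶜ = fun i j => decide (i ≠ j) && mcadj i j := by
    funext i j
    rw [Bool.eq_iff_iff, adjB_iff]
    by_cases h : i = j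
    · subst h; simp
    · rw [mcadj_iff i j h]; simp [h]
  rw [this]
  decide +kernel

theorem prod_eight (n : Fin 5 → ℕ) (h1 : ∀ i, 1 ≤ n i) (hs : ∑ i, n i = 8)
    (hb : ∀ i j, n i ≤ n j + 1) : ∏ i, n i = 8 := by
  rw [Fin.sum_univ_five] at hs
  rw [Fin.prod_univ_five]
  have h2 : ∀ i, n i = 1 ∨ n i = 2 := by
    intro i
    have := h1 i
    have b0 := hb i 0
    have b1 := hb i 1
    have b2 := hb i 2
    have b3 := hb i 3
    have b4 := hb i 4
    omega
  rcases h2 0 with e0 | e0 <;> rcases h2 1 with e1 | e1 <;> rcases h2 2 with e2 | e2 <;>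
    rcases h2 3 with e3 | e3 <;> rcases h2 4 with e4 | e4 <;>
    rw [e0, e1, e2, e3, e4] at hs ⊢ <;> omega

theorem blow_lower (G : SimpleGraph (Fin 8)) (h : IsBalancedBlowupOf C5 G) :
    8 ≤ (fam G).card := by
  classical
  rcases h with h | ⟨P, hP, hadj, hbal⟩
  · exact absurd h (by decide)
  have hprod : ∏ u : Fin 5, Fintype.card {w // P w = u} = 8 := by
    apply prod_eight
    · intro u
      obtain ⟨w, hw⟩ := hP u
      exact Fintype.card_pos_iff.mpr ⟨⟨w, hw⟩⟩
    · rw [← Fintype.card_sigma, Fintype.card_congr (Equiv.sigmaFiberEquiv P)]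
      rfl
    · intro u v
      have := hbal u v
      rwa [Nat.card_eq_fintype_card, Nat.card_eq_fintype_card] at this
  refine hprod.symm.le.trans ?_
  rw [← Fintype.card_pi, ← Finset.card_univ]
  apply Finset.card_le_card_of_injOn
    (fun g : (u : Fin 5) → {w // P w = u} => Finset.univ.image (fun u => (g u).1))
  · intro g _
    have hinj : Function.Injective (fun u => (g u).1) := by
      intro u v huv
      have := congrArg P huv
      simpa only [(g u).2, (g v).2] using this
    simp only [fam, Finset.coe_filter, Set.mem_ofPred_eq, Finset.mem_powersetCard,
      Finset.subset_univ, true_and]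
    refine ⟨by rw [Finset.card_image_of_injective _ hinj]; simp, ?_⟩
    rw [cyc_range_iff G _ (fun u => (g u).1) hinj (by simp)]
    have : G.comap (fun u => (g u).1) = C5 := by
      ext u v
      rw [SimpleGraph.comap_adj]
      by_cases huv : u = v
      · subst huv; simp
      · rw [hadj _ _ (by rw [(g u).2, (g v).2]; exact huv), (g u).2, (g v).2]
    rw [this]
    exact ⟨SimpleGraph.Iso.refl⟩
  · intro g _ g' _ hgg
    funext u
    apply Subtype.ext
    have hmem : (g u).1 ∈ Finset.univ.image (fun u => (g' u).1) := by
      have hgg : Finset.univ.image (fun u => (g u).1) = Finset.univ.image (fun u => (g' u).1) := hgg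
      rw [← hgg]
      exact Finset.mem_image_of_mem _ (Finset.mem_univ u)
    obtain ⟨v, -, hv⟩ := Finset.mem_image.mp hmem
    have := congrArg P hv
    rw [(g u).2, (g' v).2] at this
    subst this
    exact hv.symm

theorem good_lower (G : SimpleGraph (Fin 8)) (h : Good G) : 8 ≤ (fam G).card := by
  rcases h with h | ⟨⟨h⟩⟩ | ⟨⟨h⟩⟩
  · exact blow_lower G h
  · rw [fam_iso _ _ h, fam_M8]
  · rw [fam_iso _ _ h, fam_M8c]

theorem le_eight (G : SimpleGraph (Fin 8)) : (fam G).card ≤ 8 := by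
  by_contra! h
  have := (main_upper G h.le).1
  omega

/-- A graph on 8 vertices maximizes the number of induced copies of `C5` iff it is a
balanced blow-up of `C5`, the Möbius ladder `M8`, or the complement of `M8`; moreover
the maximum number of induced copies of `C5` among 8-vertex graphs equals 8. -/
theorem extremal_eight_vertices :
    (∀ G : SimpleGraph (Fin 8),
      (∀ G' : SimpleGraph (Fin 8), c5 G' ≤ c5 G) ↔
        (IsBalancedBlowupOf C5 G ∨ Nonempty (G ≃g M8) ∨ Nonempty (G ≃g M8ᶜ))) ∧
    (∀ G : SimpleGraph (Fin 8), c5 G ≤ 8) ∧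
    (∃ G : SimpleGraph (Fin 8), c5 G = 8) := by
  simp only [c5_eq]
  refine ⟨fun G => ⟨fun h => ?_, fun h G' => ?_⟩, le_eight, ⟨M8, fam_M8⟩⟩
  · have := h M8
    rw [fam_M8] at this
    exact (main_upper G this).2
  · exact (le_eight G').trans (good_lower G h)
end

section
/- A graph H on 5 vertices is a fractalizer if and only if H is the complete graph K5 or its complement, the empty graph on 5 vertices. -/
/-- Depth-bounded iterated balanced blow-up: at each level, either the graph has fewer
vertices than `H`, or it is a balanced blow-up of `H` whose parts again satisfy the
condition at smaller depth. -/
def iterAux {U : Type} [Fintype U] (H : SimpleGraph U) :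
    ℕ → ∀ (W : Type), SimpleGraph W → Prop
  | 0, W, _ => Nat.card W < Fintype.card U
  | (k+1), W, G =>
      Nat.card W < Fintype.card U ∨
        ∃ P : W → U, Function.Surjective P ∧
          (∀ w w' : W, P w ≠ P w' → (G.Adj w w' ↔ H.Adj (P w) (P w'))) ∧
          (∀ u v : U, Nat.card {w : W // P w = u} ≤ Nat.card {w : W // P w = v} + 1) ∧
          ∀ u : U, iterAux H k ↥{w : W | P w = u} (G.induce {w : W | P w = u})

/-- `G` is an iterated balanced blow-up of `H`. -/
def IsIterBalancedBlowupOf {U : Type} [Fintype U] (H : SimpleGraph U)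
    {W : Type} (G : SimpleGraph W) : Prop :=
  ∃ k : ℕ, iterAux H k W G

/-- `H` is a fractalizer: for every `n`, every `n`-vertex graph maximizing the number of
induced copies of `H` is an iterated balanced blow-up of `H`. -/
def IsFractalizer {U : Type} [Fintype U] (H : SimpleGraph U) : Prop :=
  ∀ (n : ℕ) (G : SimpleGraph (Fin n)),
    (∀ G' : SimpleGraph (Fin n), inducedCopies H G' ≤ inducedCopies H G) →
      IsIterBalancedBlowupOf H G

namespace Fz
open Finset

/-! ### Invariance lemmas -/

theorem copies_iso_left {U U' V : Type} [Fintype U] [Fintype U'] [Fintype V]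
    {H : SimpleGraph U} {H' : SimpleGraph U'} (e : H ≃g H') (G : SimpleGraph V) :
    inducedCopies H G = inducedCopies H' G := by
  unfold inducedCopies
  have hc : Fintype.card U = Fintype.card U' := Fintype.card_congr e.toEquiv
  refine Nat.card_congr (Equiv.subtypeEquivRight fun s => ?_)
  rw [hc]
  refine and_congr_right fun _ => ⟨fun ⟨f⟩ => ⟨f.trans e⟩, fun ⟨f⟩ => ⟨f.trans e.symm⟩⟩

theorem copies_iso_right_le {U V W : Type} [Fintype U] [Fintype V] [Fintype W]
    (H : SimpleGraph U) {G : SimpleGraph V} {G' : SimpleGraph W} (e : G ≃g G') :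
    inducedCopies H G ≤ inducedCopies H G' := by
  classical
  unfold inducedCopies
  refine Nat.card_le_card_of_injective
    (fun s => ⟨s.1.map e.toEquiv.toEmbedding, by simpa using s.2.1, ?_⟩) ?_
  · obtain ⟨f⟩ := s.2.2
    refine ⟨RelIso.trans (RelIso.symm ?_) f⟩
    refine ⟨(e.toEquiv.image _).trans (Equiv.setCongr (by simp)), ?_⟩
    intro a b
    exact e.map_rel_iff
  · intro s t h
    have := congrArg Subtype.val h
    exact Subtype.ext (Finset.map_injective _ this)

theorem copies_iso_right {U V W : Type} [Fintype U] [Fintype V] [Fintype W]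
    (H : SimpleGraph U) {G : SimpleGraph V} {G' : SimpleGraph W} (e : G ≃g G') :
    inducedCopies H G = inducedCopies H G' :=
  le_antisymm (copies_iso_right_le H e) (copies_iso_right_le H e.symm)

theorem copies_compl {U V : Type} [Fintype U] [Fintype V]
    (H : SimpleGraph U) (G : SimpleGraph V) :
    inducedCopies Hᶜ Gᶜ = inducedCopies H G := by
  unfold inducedCopies
  refine Nat.card_congr (Equiv.subtypeEquivRight fun s => and_congr_right fun _ => ?_)
  constructor
  · rintro ⟨f⟩
    refine ⟨⟨f.toEquiv, ?_⟩⟩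
    intro a b
    have h := f.map_rel_iff (a := a) (b := b)
    simp only [SimpleGraph.compl_adj, SimpleGraph.comap_adj, SimpleGraph.induce] at h ⊢
    by_cases hab : a = b
    · subst hab; simp
    · have h1 : f a ≠ f b := fun h => hab (f.injective h)
      have h2 : (a : V) ≠ b := fun h => hab (Subtype.ext h)
      have h3 : f.toEquiv a = f a := rfl
      have h4 : f.toEquiv b = f b := rfl
      rw [h3, h4] at *
      simp only [ne_eq, h1, not_false_eq_true, true_and] at h
      have : (Function.Embedding.subtype (· ∈ (s : Set V))) a ≠
        (Function.Embedding.subtype (· ∈ (s : Set V))) b := h2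
      tauto
  · rintro ⟨f⟩
    refine ⟨⟨f.toEquiv, ?_⟩⟩
    intro a b
    have h := f.map_rel_iff (a := a) (b := b)
    simp only [SimpleGraph.compl_adj, SimpleGraph.comap_adj, SimpleGraph.induce] at h ⊢
    by_cases hab : a = b
    · subst hab; simp
    · have h1 : f a ≠ f b := fun h => hab (f.injective h)
      have h2 : (a : V) ≠ b := fun h => hab (Subtype.ext h)
      have h3 : f.toEquiv a = f a := rfl
      have h4 : f.toEquiv b = f b := rfl
      rw [h3, h4] at *
      have : (Function.Embedding.subtype (· ∈ (s : Set V))) a ≠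
        (Function.Embedding.subtype (· ∈ (s : Set V))) b := h2
      tauto

theorem iter_iso {U U' : Type} [Fintype U] [Fintype U']
    {H : SimpleGraph U} {H' : SimpleGraph U'} (e : H ≃g H') :
    ∀ (k : ℕ) (W : Type) (G : SimpleGraph W), iterAux H k W G → iterAux H' k W G := by
  have hc : Fintype.card U = Fintype.card U' := Fintype.card_congr e.toEquiv
  intro k
  induction k with
  | zero => intro W G h; simpa [iterAux, ← hc] using h
  | succ k ih =>
    intro W G h
    rcases h with h | ⟨P, hs, ha, hb, hi⟩
    · exact Or.inl (hc ▸ h)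
    · have key : ∀ u w, (e (P w) = u) ↔ P w = e.symm u := by
        intro u w
        exact ⟨fun h => by rw [← h]; simp, fun h => by rw [h]; simp⟩
      refine Or.inr ⟨fun w => e (P w), e.surjective.comp hs, ?_, ?_, ?_⟩
      · intro w w' hne
        rw [ha w w' (fun h => hne (congrArg e h))]
        exact e.map_rel_iff.symm
      · intro u v
        simpa only [key] using hb (e.symm u) (e.symm v)
      · intro u
        have : {w : W | e (P w) = u} = {w : W | P w = e.symm u} := by
          ext w; exact key u w
        rw [this]
        exact ih _ _ (hi (e.symm u))

theorem induce_compl {W : Type} (G : SimpleGraph W) (s : Set W) :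
    Gᶜ.induce s = (G.induce s)ᶜ := by
  ext a b
  simp [SimpleGraph.compl_adj, Subtype.ext_iff]

theorem iter_compl {U : Type} [Fintype U] {H : SimpleGraph U} :
    ∀ (k : ℕ) (W : Type) (G : SimpleGraph W), iterAux H k W G → iterAux Hᶜ k W Gᶜ := by
  intro k
  induction k with
  | zero => intro W G h; exact h
  | succ k ih =>
    intro W G h
    rcases h with h | ⟨P, hs, ha, hb, hi⟩
    · exact Or.inl h
    · refine Or.inr ⟨P, hs, ?_, hb, ?_⟩
      · intro w w' hne
        have h1 := ha w w' hne
        have h2 : w ≠ w' := fun h => hne (by rw [h])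
        simp [SimpleGraph.compl_adj, h1, h2, hne]
      · intro u
        rw [induce_compl]
        exact ih _ _ (hi u)

theorem frac_iso {U U' : Type} [Fintype U] [Fintype U']
    {H : SimpleGraph U} {H' : SimpleGraph U'} (e : H ≃g H') (h : IsFractalizer H) :
    IsFractalizer H' := by
  intro n G hG
  obtain ⟨k, hk⟩ := h n G (fun G' => by
    rw [copies_iso_left e, copies_iso_left e]; exact hG G')
  exact ⟨k, iter_iso e k _ _ hk⟩

theorem frac_compl {U : Type} [Fintype U]
    {H : SimpleGraph U} (h : IsFractalizer H) : IsFractalizer Hᶜ := by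
  intro n G hG
  obtain ⟨k, hk⟩ := h n Gᶜ (fun G' => by
    have := hG G'ᶜ
    rw [copies_compl] at this
    rwa [← copies_compl H Gᶜ, compl_compl])
  have := iter_compl k _ _ hk
  rw [compl_compl] at this
  exact ⟨k, this⟩

theorem exists_max (n : ℕ) {U : Type} [Fintype U] (H : SimpleGraph U) :
    ∃ G : SimpleGraph (Fin n), ∀ G' : SimpleGraph (Fin n),
      inducedCopies H G' ≤ inducedCopies H G :=
  Finite.exists_max (fun G : SimpleGraph (Fin n) => inducedCopies H G)

/-! ### The complete graph -/

theorem copies_eq_card {U V : Type} [Fintype U] [Fintype V]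
    (H : SimpleGraph U) (G : SimpleGraph V) [DecidablePred fun s : Finset V =>
      Nonempty (G.induce (s : Set V) ≃g H)] :
    inducedCopies H G = (((univ : Finset V).powersetCard (Fintype.card U)).filter
      (fun s : Finset V => Nonempty (G.induce (s : Set V) ≃g H))).card := by
  classical
  unfold inducedCopies
  rw [Nat.card_eq_fintype_card, Fintype.card_subtype]
  congr 1
  ext s
  simp

theorem iter_top : ∀ (k : ℕ) (W : Type), Nat.card W ≤ k →
    iterAux (⊤ : SimpleGraph (Fin 5)) k W ⊤ := by
  intro k
  induction k with
  | zero => intro W h; simp only [iterAux, Fintype.card_fin]; omega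
  | succ k ih =>
    intro W h
    by_cases h5 : Nat.card W < 5
    · exact Or.inl (by simpa using h5)
    right
    have hfin : Finite W := Nat.finite_of_card_ne_zero (by omega)
    have e : W ≃ Fin (Nat.card W) := Finite.equivFin W
    generalize Nat.card W = m at *
    have hcard : ∀ u : Fin 5,
        Nat.card {w : W // (⟨(e w : ℕ) % 5, Nat.mod_lt _ (by norm_num)⟩ : Fin 5) = u}
        = m / 5 + if (u : ℕ) % 5 < m % 5 then 1 else 0 := by
      intro u
      rw [← Nat.count_modEq_card m (by norm_num) (u : ℕ), Nat.count_eq_card_fintype,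
        Fintype.card_eq_nat_card]
      refine Nat.card_congr ⟨fun w => ⟨e w.1, (e w.1).2, ?_⟩,
        fun x => ⟨e.symm ⟨x.1, x.2.1⟩, ?_⟩, ?_, ?_⟩
      · have := congrArg Fin.val w.2
        simp only at this
        have h2 := u.2
        rw [Nat.ModEq]; omega
      · have := x.2.2
        rw [Nat.ModEq] at this
        have h2 := u.2
        ext
        simp only [Equiv.apply_symm_apply]
        omega
      · intro w; simp
      · intro x; simp
    refine ⟨fun w => ⟨(e w : ℕ) % 5, Nat.mod_lt _ (by norm_num)⟩, ?_, ?_, ?_, ?_⟩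
    · intro u
      refine ⟨e.symm ⟨u, by omega⟩, ?_⟩
      ext
      simp
    · intro w w' hne
      have : w ≠ w' := fun h => hne (by rw [h])
      simp only [SimpleGraph.top_adj]
      exact ⟨fun _ => hne, fun _ => this⟩
    · intro u v
      rw [hcard, hcard]
      split_ifs <;> omega
    · intro u
      have hi : (⊤ : SimpleGraph W).induce
          {w : W | (⟨(e w : ℕ) % 5, Nat.mod_lt _ (by norm_num)⟩ : Fin 5) = u} = ⊤ := by
        ext a b
        simp [Subtype.ext_iff]
      rw [hi]
      apply ih
      have := hcard u
      refine le_trans (le_of_eq this) ?_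
      split_ifs <;> omega

theorem frac_top : IsFractalizer (⊤ : SimpleGraph (Fin 5)) := by
  classical
  intro n G hG
  by_cases hn : n < 5
  · exact ⟨0, by simpa [iterAux] using hn⟩
  have h1 := hG ⊤
  rw [copies_eq_card, copies_eq_card, Fintype.card_fin] at h1
  have h2 : ((univ : Finset (Fin n)).powersetCard 5).filter
      (fun s : Finset (Fin n) => Nonempty ((⊤ : SimpleGraph (Fin n)).induce (s : Set (Fin n)) ≃g
        (⊤ : SimpleGraph (Fin 5)))) = (univ : Finset (Fin n)).powersetCard 5 := by
    rw [Finset.filter_eq_self]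
    intro s hs
    rw [Finset.mem_powersetCard] at hs
    have e : s ≃ Fin 5 := Fintype.equivFinOfCardEq (by simpa using hs.2)
    refine ⟨⟨e, ?_⟩⟩
    intro a b
    have h1 : e a = e b ↔ a = b := e.injective.eq_iff
    simp only [SimpleGraph.top_adj, SimpleGraph.comap_adj, ne_eq, SimpleGraph.induce]
    rw [h1]
    exact not_congr Subtype.ext_iff
  rw [h2] at h1
  have h3 := Finset.eq_of_subset_of_card_le (Finset.filter_subset _ _) h1
  have hG' : G = ⊤ := by
    ext a b
    simp only [SimpleGraph.top_adj]
    refine ⟨fun h => h.ne, fun hab => ?_⟩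
    obtain ⟨s, hs, hs5⟩ := Finset.exists_superset_card_eq (s := {a, b}) (n := 5)
      (by rw [Finset.card_pair hab]; norm_num) (by simpa using hn)
    have hm : s ∈ (univ : Finset (Fin n)).powersetCard 5 := by simp [hs5]
    rw [← h3, Finset.mem_filter] at hm
    obtain ⟨f⟩ := hm.2
    have ha : a ∈ s := hs (by simp)
    have hb : b ∈ s := hs (by simp)
    have := f.map_rel_iff (a := ⟨a, ha⟩) (b := ⟨b, hb⟩)
    simp only [SimpleGraph.top_adj] at this
    exact this.1 (fun h => hab (congrArg Subtype.val (f.injective h)))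
  subst hG'
  exact ⟨n, iter_top n _ (by simp)⟩

end Fz
namespace Fz
open Finset

/-! ### Graphs encoded by natural numbers -/

/-- The bit of `A` at position `k`, as a number. -/
def bit (A k : ℕ) : ℕ := Nat.land (Nat.shiftRight A k) 1

theorem bit_eq (A k : ℕ) : bit A k = (A.testBit k).toNat := by
  show (A >>> k) &&& 1 = _
  rw [Nat.toNat_testBit, Nat.shiftRight_eq_div_pow, Nat.and_one_is_mod]

theorem bit_eq_one (A k : ℕ) : bit A k = 1 ↔ A.testBit k = true := by
  rw [bit_eq]; cases A.testBit k <;> simp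

theorem bit_lt (A k : ℕ) : bit A k < 2 := by
  rw [bit_eq]; cases A.testBit k <;> simp

/-- Index of the pair `i, j` in the triangular ordering. -/
def ix (i j : ℕ) : ℕ := if i < j then j * (j - 1) / 2 + i else i * (i - 1) / 2 + j

theorem ix_comm (i j : ℕ) : ix i j = ix j i := by
  unfold ix
  rcases lt_trichotomy i j with h | h | h
  · simp [h, h.not_gt]
  · simp [h]
  · simp [h, h.not_gt]

/-- The graph on five vertices with code `c`. -/
def gr (c : ℕ) : SimpleGraph (Fin 5) where
  Adj i j := i ≠ j ∧ bit c (ix i j) = 1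
  symm := ⟨fun i j h => ⟨h.1.symm, by rw [ix_comm]; exact h.2⟩⟩
  loopless := ⟨fun i h => h.1 rfl⟩

/-- The code of the graph on the ordered vertices `v₀ … v₄`. -/
def code5 (f : ℕ → ℕ → ℕ) (v0 v1 v2 v3 v4 : ℕ) : ℕ :=
  f v0 v1 + 2 * (f v0 v2 + 2 * (f v1 v2 + 2 * (f v0 v3 + 2 * (f v1 v3 + 2 * (f v2 v3 +
    2 * (f v0 v4 + 2 * (f v1 v4 + 2 * (f v2 v4 + 2 * f v3 v4))))))))

theorem code_bits : ∀ a b c d e f g h i j : Fin 2,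
    let x : ℕ := a + 2 * (b + 2 * (c + 2 * (d + 2 * (e + 2 * (f + 2 * (g + 2 * (h + 2 * (i + 2 * j))))))))
    x < 1024 ∧ bit x 0 = a ∧ bit x 1 = b ∧ bit x 2 = c ∧ bit x 3 = d ∧ bit x 4 = e ∧ bit x 5 = f ∧
      bit x 6 = g ∧ bit x 7 = h ∧ bit x 8 = i ∧ bit x 9 = j := by
  decide +kernel

theorem code5_spec (f : ℕ → ℕ → ℕ) (hf : ∀ a b, f a b < 2) (v : Fin 5 → ℕ)
    (hs : ∀ i j, f (v i) (v j) = f (v j) (v i)) :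
    code5 f (v 0) (v 1) (v 2) (v 3) (v 4) < 1024 ∧
    ∀ i j : Fin 5, i ≠ j →
      bit (code5 f (v 0) (v 1) (v 2) (v 3) (v 4)) (ix i j) = f (v i) (v j) := by
  have h := code_bits ⟨_, hf (v 0) (v 1)⟩ ⟨_, hf (v 0) (v 2)⟩ ⟨_, hf (v 1) (v 2)⟩
    ⟨_, hf (v 0) (v 3)⟩ ⟨_, hf (v 1) (v 3)⟩ ⟨_, hf (v 2) (v 3)⟩
    ⟨_, hf (v 0) (v 4)⟩ ⟨_, hf (v 1) (v 4)⟩ ⟨_, hf (v 2) (v 4)⟩ ⟨_, hf (v 3) (v 4)⟩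
  have hX : ∃ X, X = code5 f (v 0) (v 1) (v 2) (v 3) (v 4) := ⟨_, rfl⟩
  obtain ⟨X, hX⟩ := hX
  have hX' := hX
  unfold code5 at hX'
  simp only at h
  rw [← hX'] at h
  rw [← hX]
  clear hX hX'
  obtain ⟨h, h0, h1, h2, h3, h4, h5, h6, h7, h8, h9⟩ := h
  refine ⟨h, ?_⟩
  intro i j hij
  have key : ∀ i j : Fin 5, i < j → bit X (ix i j) = f (v i) (v j) := by
    intro i j hij
    fin_cases i <;> fin_cases j <;>
      first
      | (exfalso; revert hij; decide)
      | exact h0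
      | exact h1
      | exact h2
      | exact h3
      | exact h4
      | exact h5
      | exact h6
      | exact h7
      | exact h8
      | exact h9
  rcases lt_or_gt_of_ne hij with h | h
  · exact key i j h
  · rw [ix_comm, key j i h, hs]

/-- Two graphs on five vertices with the same bits agree. -/
theorem gr_surj (H : SimpleGraph (Fin 5)) : ∃ c, c < 1024 ∧ gr c = H := by
  classical
  have hs := code5_spec (fun a b => if ∃ (ha : a < 5) (hb : b < 5), H.Adj ⟨a, ha⟩ ⟨b, hb⟩ then 1 else 0)
    (by intro a b; split_ifs <;> norm_num) (fun i => i) (by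
      intro i j
      simp [H.adj_comm])
  refine ⟨_, hs.1, ?_⟩
  ext i j
  by_cases hij : i = j
  · subst hij; simp
  · show _ ∧ _ ↔ _
    rw [hs.2 i j hij]
    simp [hij]

theorem gr_compl (c : ℕ) (hc : c < 1024) : gr (1023 - c) = (gr c)ᶜ := by
  have key : ∀ c < 1024, ∀ k < 10, bit (1023 - c) k = 1 - bit c k := by decide +kernel
  have hix : ∀ i j : Fin 5, i ≠ j → ix i j < 10 := by decide
  ext i j
  by_cases hij : i = j
  · subst hij; simp
  · have h := key c hc _ (hix i j hij)
    have h2 := bit_lt c (ix i j)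
    simp only [SimpleGraph.compl_adj]
    show _ ∧ _ ↔ _ ∧ ¬ (_ ∧ _)
    rw [h]
    simp only [hij, ne_eq, not_false_eq_true, true_and]
    omega

/-- All permutations of `0 … 4`, as lists. -/
def perms5 : List (List ℕ) := [0, 1, 2, 3, 4].permutations'

def actL (c : ℕ) : List ℕ → ℕ
  | [a, b, x, y, z] => code5 (fun i j => bit c (ix i j)) a b x y z
  | _ => 0

/-- The bit mask of all codes of graphs isomorphic to `gr c`. -/
def maskL (c : ℕ) : List (List ℕ) → ℕ
  | [] => 0
  | p :: l => Nat.lor (Nat.shiftLeft 1 (actL c p)) (maskL c l)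

theorem maskL_spec (c d : ℕ) (l : List (List ℕ)) :
    bit (maskL c l) d = 1 ↔ ∃ p ∈ l, actL c p = d := by
  rw [bit_eq_one]
  induction l with
  | nil => simp [maskL]
  | cons p l ih =>
    show ((1 <<< actL c p) ||| maskL c l).testBit d = true ↔ _
    rw [Nat.testBit_or, Bool.or_eq_true, ih, Nat.one_shiftLeft, Nat.testBit_two_pow]
    simp

theorem gr_iso_iff (c d : ℕ) (hd : d < 1024) :
    bit (maskL c perms5) d = 1 ↔ Nonempty (gr d ≃g gr c) := by
  have hinj : ∀ d < 1024, ∀ d' < 1024, (∀ i j : Fin 5, i ≠ j → bit d (ix i j) = bit d' (ix i j)) → d = d' := by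
    intro d hd d' hd' h
    apply Nat.eq_of_testBit_eq
    intro k
    by_cases hk : k < 10
    · have : ∃ i j : Fin 5, i ≠ j ∧ ix i j = k := by
        revert k; decide
      obtain ⟨i, j, hij, rfl⟩ := this
      have := h i j hij
      rw [bit_eq, bit_eq] at this
      revert this; cases d.testBit (ix i j) <;> cases d'.testBit (ix i j) <;> simp
    · rw [Nat.testBit_lt_two_pow, Nat.testBit_lt_two_pow]
      · exact hd'.trans_le (by calc 1024 = 2 ^ 10 := by norm_num
                                 _ ≤ 2 ^ k := Nat.pow_le_pow_right (by norm_num) (by omega))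
      · exact hd.trans_le (by calc 1024 = 2 ^ 10 := by norm_num
                                 _ ≤ 2 ^ k := Nat.pow_le_pow_right (by norm_num) (by omega))
  have hact : ∀ v : Fin 5 → ℕ, actL c (List.ofFn v) < 1024 ∧ ∀ i j : Fin 5, i ≠ j →
      bit (actL c (List.ofFn v)) (ix i j) = bit c (ix (v i) (v j)) := by
    intro v
    have := code5_spec (fun i j => bit c (ix i j)) (fun a b => bit_lt _ _) v
      (fun i j => by simp only [ix_comm])
    simpa [List.ofFn_succ, actL] using this
  have hl : List.ofFn (fun i : Fin 5 => (i : ℕ)) = [0, 1, 2, 3, 4] := by decide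
  rw [maskL_spec]
  constructor
  · rintro ⟨p, hp, rfl⟩
    rw [perms5, List.mem_permutations', ← hl] at hp
    have hlen : p.length = 5 := by rw [hp.length_eq]; simp
    obtain ⟨v, rfl⟩ : ∃ v : Fin 5 → ℕ, List.ofFn v = p := by
      match p, hlen with
      | [a, b, x, y, z], _ => exact ⟨![a, b, x, y, z], by simp [List.ofFn_succ]⟩
    have hnd : (List.ofFn v).Nodup := hp.nodup_iff.2 (by rw [hl]; decide)
    have hvi : Function.Injective v := List.nodup_ofFn.1 hnd
    have hv5 : ∀ i, v i < 5 := by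
      intro i
      have : v i ∈ List.ofFn v := (List.mem_ofFn' _ _).2 ⟨i, rfl⟩
      rw [hp.mem_iff, hl] at this
      simp at this
      omega
    let σ : Fin 5 → Fin 5 := fun i => ⟨v i, hv5 i⟩
    have hσ : Function.Injective σ := fun i j h => hvi (congrArg Fin.val h)
    refine ⟨⟨Equiv.ofBijective σ (Finite.injective_iff_bijective.1 hσ), ?_⟩⟩
    intro i j
    show (_ ∧ _) ↔ (_ ∧ _)
    by_cases hij : i = j
    · subst hij; simp
    · have : σ i ≠ σ j := fun h => hij (hσ h)
      have h2 := (hact v).2 i j hij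
      rw [h2]
      simp [hij, this, σ]
  · rintro ⟨f⟩
    refine ⟨List.ofFn (fun i => (f i : ℕ)), ?_, ?_⟩
    · rw [perms5, List.mem_permutations', ← hl]
      refine Equiv.Perm.ofFn_comp_perm f.toEquiv (fun i : Fin 5 => (i : ℕ))
    · refine hinj _ (hact _).1 _ hd ?_
      intro i j hij
      rw [(hact _).2 i j hij]
      have := f.map_rel_iff (a := i) (b := j)
      have h1 : f i ≠ f j := fun h => hij (f.injective h)
      have h2 := bit_lt c (ix (f i) (f j))
      have h3 := bit_lt d (ix i j)
      change (_ ∧ _) ↔ (_ ∧ _) at this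
      simp only [hij, h1, ne_eq, not_false_eq_true, true_and] at this
      have h4 : bit c (ix (f i) (f j)) = 1 ↔ bit d (ix i j) = 1 := this
      omega

end Fz
namespace Fz
open Finset

/-! ### Counting induced copies by computation -/

/-- Entry of the `n × n` bit matrix `A`. -/
def mbit (n A i j : ℕ) : ℕ := bit A (Nat.add (Nat.mul n i) j)

/-- The graph on `Fin n` with adjacency bit matrix `A`. -/
def matG (n A : ℕ) : SimpleGraph (Fin n) where
  Adj x y := x ≠ y ∧ mbit n A x y = 1 ∧ mbit n A y x = 1
  symm := ⟨fun _ _ h => ⟨h.1.symm, h.2.2, h.2.1⟩⟩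
  loopless := ⟨fun _ h => h.1 rfl⟩

def SymM (n A : ℕ) : Prop := ∀ x < n, ∀ y < n, mbit n A x y = mbit n A y x

instance (n A : ℕ) : Decidable (SymM n A) := by unfold SymM; infer_instance

theorem matG_adj {n A : ℕ} (h : SymM n A) {x y : Fin n} (hxy : x ≠ y) :
    (matG n A).Adj x y ↔ mbit n A x y = 1 := by
  show (_ ∧ _ ∧ _) ↔ _
  rw [← h x x.2 y y.2]
  simp [hxy]

def pA (n A mask : ℕ) : List ℕ → ℕ
  | [a, b, c, d, e] => bit mask (code5 (mbit n A) a b c d e)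
  | _ => 0

def cnt (p : List ℕ → ℕ) : List ℕ → ℕ → List ℕ → ℕ
  | _, 0, acc => p acc
  | [], _ + 1, _ => 0
  | x :: l, k + 1, acc => Nat.add (cnt p l (k + 1) acc) (cnt p l k (x :: acc))

/-- `s` spans an induced copy of `gr c`. -/
def Good {n : ℕ} (G : SimpleGraph (Fin n)) (c : ℕ) (s : Finset (Fin n)) : Prop :=
  Nonempty (G.induce (s : Set (Fin n)) ≃g gr c)

open Classical in
theorem pA_spec {n A c : ℕ} (hA : SymM n A) (acc : List (Fin n))
    (hnd : acc.Nodup) (hlen : acc.length = 5) :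
    pA n A (maskL c perms5) (acc.map Fin.val) =
      if Good (matG n A) c acc.toFinset then 1 else 0 := by
  obtain ⟨v, rfl⟩ : ∃ v : Fin 5 → Fin n, List.ofFn v = acc := by
    match acc, hlen with
    | [a, b, x, y, z], _ => exact ⟨![a, b, x, y, z], by simp [List.ofFn_succ]⟩
  have hv : Function.Injective v := List.nodup_ofFn.1 hnd
  have hc := code5_spec (mbit n A) (fun a b => bit_lt _ _) (fun i => (v i : ℕ))
    (fun i j => hA _ (v i).2 _ (v j).2)
  have hp : pA n A (maskL c perms5) ((List.ofFn v).map Fin.val) =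
      bit (maskL c perms5) (code5 (mbit n A) (v 0) (v 1) (v 2) (v 3) (v 4)) := by
    simp [List.ofFn_succ, pA]
  rw [hp]
  generalize code5 (mbit n A) (v 0) (v 1) (v 2) (v 3) (v 4) = d at hc
  have hiso : Nonempty (gr d ≃g (matG n A).induce ((List.ofFn v).toFinset : Set (Fin n))) := by
    have hm : ∀ i, v i ∈ ((List.ofFn v).toFinset : Set (Fin n)) := by
      intro i
      rw [Finset.mem_coe, List.mem_toFinset, List.mem_ofFn]
      exact ⟨i, rfl⟩
    refine ⟨⟨Equiv.ofBijective (fun i => ⟨v i, hm i⟩) ⟨?_, ?_⟩, ?_⟩⟩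
    · intro i j h
      exact hv (congrArg Subtype.val h)
    · rintro ⟨w, hw⟩
      rw [Finset.mem_coe, List.mem_toFinset, List.mem_ofFn] at hw
      obtain ⟨i, rfl⟩ := hw
      exact ⟨i, rfl⟩
    · intro i j
      show (matG n A).Adj (v i) (v j) ↔ (_ ∧ _)
      by_cases hij : i = j
      · subst hij; simp
      · rw [matG_adj hA (fun h => hij (hv h)), hc.2 i j hij]
        simp [hij]
  have hb := bit_lt (maskL c perms5) d
  have hi := gr_iso_iff c d hc.1
  have hg : Good (matG n A) c (List.ofFn v).toFinset ↔ Nonempty (gr d ≃g gr c) := by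
    obtain ⟨f⟩ := hiso
    exact ⟨fun ⟨g⟩ => ⟨f.trans g⟩, fun ⟨g⟩ => ⟨f.symm.trans g⟩⟩
  rw [hg, ← hi]
  split_ifs with h
  · exact h
  · omega

open Classical in
theorem cnt_spec {n A c : ℕ} (hA : SymM n A) : ∀ (l : List (Fin n)) (k : ℕ) (acc : List (Fin n)),
    (l ++ acc).Nodup → acc.length + k = 5 →
    cnt (pA n A (maskL c perms5)) (l.map Fin.val) k (acc.map Fin.val) =
      ((l.toFinset.powersetCard k).filter
        (fun T => Good (matG n A) c (T ∪ acc.toFinset))).card := by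
  intro l
  induction l with
  | nil =>
    intro k acc hnd hlen
    cases k with
    | zero =>
      rw [List.map_nil, cnt, pA_spec hA acc (by simpa using hnd) (by simpa using hlen)]
      simp [Finset.filter_singleton]
      split_ifs <;> simp
    | succ k =>
      rw [List.map_nil, cnt, List.toFinset_nil, Finset.powersetCard_eq_empty.2 (by simp),
        Finset.filter_empty, Finset.card_empty]
  | cons x l ih =>
    intro k acc hnd hlen
    cases k with
    | zero =>
      have : cnt (pA n A (maskL c perms5)) ((x :: l).map Fin.val) 0 (acc.map Fin.val)
        = pA n A (maskL c perms5) (acc.map Fin.val) := by simp [cnt]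
      rw [this, pA_spec hA acc (by exact (List.nodup_append.1 hnd).2.1) (by simpa using hlen)]
      simp [Finset.filter_singleton]
      split_ifs <;> simp
    | succ k =>
      have hx : x ∉ l ++ acc := by
        rw [List.cons_append, List.nodup_cons] at hnd; exact hnd.1
      have hxl : x ∉ l := fun h => hx (by simp [h])
      have hnd' : (l ++ acc).Nodup := by
        rw [List.cons_append, List.nodup_cons] at hnd; exact hnd.2
      have h1 := ih (k + 1) acc hnd' hlen
      have h2 := ih k (x :: acc) (List.nodup_middle.2 (by simpa using hnd))
        (by simp only [List.length_cons]; omega)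
      rw [List.map_cons] at h2
      rw [List.map_cons, cnt, h1, h2, List.toFinset_cons (a := x) (l := l),
        Finset.powersetCard_succ_insert (by simpa using hxl), Finset.filter_union]
      rw [Finset.card_union_of_disjoint]
      · rw [Nat.add_eq]
        congr 1
        rw [Finset.filter_image, Finset.card_image_of_injOn]
        · congr 1
          ext T
          simp only [Finset.mem_filter, List.toFinset_cons]
          rw [show insert x T ∪ acc.toFinset = T ∪ insert x acc.toFinset by
            ext; simp only [mem_union, mem_insert]; tauto]
        · intro T hT T' hT' h
          simp only [coe_filter, Set.mem_ofPred_eq, mem_powersetCard] at hT hT'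
          have e1 : x ∉ T := fun h => hxl (by simpa using hT.1.1 h)
          have e2 : x ∉ T' := fun h => hxl (by simpa using hT'.1.1 h)
          rw [← Finset.erase_insert e1, h, Finset.erase_insert e2]
      · rw [Finset.disjoint_left]
        intro T hT hT'
        simp only [mem_filter, mem_powersetCard, mem_image] at hT hT'
        obtain ⟨⟨T', _, rfl⟩, _⟩ := hT'
        exact hxl (by simpa using hT.1.1 (mem_insert_self x T'))

theorem copies_eq_cnt {n A c : ℕ} (hA : SymM n A) (l : List (Fin n)) (hl : l.Nodup)
    (hall : ∀ x, x ∈ l) :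
    inducedCopies (gr c) (matG n A) = cnt (pA n A (maskL c perms5)) (l.map Fin.val) 5 [] := by
  classical
  have h := cnt_spec (c := c) hA l 5 [] (by simpa using hl) (by simp)
  rw [List.map_nil] at h
  rw [h, copies_eq_card]
  have : l.toFinset = univ := by ext x; simp [hall]
  rw [this, Fintype.card_fin]
  congr 1
  refine Finset.ext fun s => ?_
  rw [Finset.mem_filter, Finset.mem_filter, List.toFinset_nil, Finset.union_empty]
  rfl

/-- Flipping the pair `x, y` changes only the copies through both. -/
theorem flip_lt {n A A' c : ℕ} (hA : SymM n A) (hA' : SymM n A') (x y : Fin n) (r : List (Fin n))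
    (hnd : (x :: y :: r).Nodup) (hall : ∀ z, z ∈ x :: y :: r)
    (hflip : ∀ a < n, ∀ b < n, a = x ∧ b = y ∨ a = y ∧ b = x ∨ mbit n A a b = mbit n A' a b)
    (hlt : cnt (pA n A (maskL c perms5)) (r.map Fin.val) 3 [y, x] <
      cnt (pA n A' (maskL c perms5)) (r.map Fin.val) 3 [y, x]) :
    inducedCopies (gr c) (matG n A) < inducedCopies (gr c) (matG n A') := by
  classical
  rw [copies_eq_cnt hA _ hnd hall, copies_eq_cnt hA' _ hnd hall]
  simp only [List.map_cons, cnt]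
  have hxy : x ≠ y := by simp at hnd; tauto
  have hgood : ∀ s : Finset (Fin n), ¬ (x ∈ s ∧ y ∈ s) →
      (Good (matG n A) c s ↔ Good (matG n A') c s) := by
    intro s hs
    have : (matG n A).induce (s : Set (Fin n)) = (matG n A').induce (s : Set (Fin n)) := by
      ext a b
      show (matG n A).Adj a b ↔ (matG n A').Adj a b
      by_cases hab : (a : Fin n) = b
      · rw [hab]; simp
      · rw [matG_adj hA hab, matG_adj hA' hab]
        have ha : (a : Fin n) ∈ s := a.2
        have hb : (b : Fin n) ∈ s := b.2
        rcases hflip a a.1.2 b b.1.2 with h | h | h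
        · exact absurd ⟨Fin.ext h.1 ▸ ha, Fin.ext h.2 ▸ hb⟩ hs
        · exact absurd ⟨Fin.ext h.2 ▸ hb, Fin.ext h.1 ▸ ha⟩ hs
        · rw [h]
    unfold Good
    rw [this]
  have hxr : x ∉ r := by simp at hnd; tauto
  have hyr : y ∉ r := by simp at hnd; tauto
  have hr : r.Nodup := by simp at hnd; tauto
  have key : ∀ (k : ℕ) (acc : List (Fin n)), acc.length + k = 5 → (r ++ acc).Nodup →
      ¬ (x ∈ acc ∧ y ∈ acc) →
      cnt (pA n A (maskL c perms5)) (r.map Fin.val) k (acc.map Fin.val) =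
      cnt (pA n A' (maskL c perms5)) (r.map Fin.val) k (acc.map Fin.val) := by
    intro k acc hk hn hacc
    rw [cnt_spec hA r k acc hn hk, cnt_spec hA' r k acc hn hk]
    congr 1
    refine Finset.filter_congr fun T hT => hgood _ ?_
    rw [mem_powersetCard] at hT
    have e1 : x ∉ T := fun h => hxr (by simpa using hT.1 h)
    have e2 : y ∉ T := fun h => hyr (by simpa using hT.1 h)
    simpa [e1, e2] using hacc
  have k1 := key 5 [] rfl (by simpa using hr) (by simp)
  have k2 := key 4 [x] rfl (by rw [List.nodup_append]; simp [hr]; exact fun a ha h => hxr (h ▸ ha)) (by simp [hxy.symm])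
  have k3 := key 4 [y] rfl (by rw [List.nodup_append]; simp [hr]; exact fun a ha h => hyr (h ▸ ha)) (by simp [hxy])
  simp only [List.map_cons, List.map_nil] at k1 k2 k3
  simp only [Nat.add_eq, Nat.reduceAdd]
  rw [k1, k2, k3]
  omega

end Fz
namespace Fz
open Finset

/-! ### Iterated balanced blow-ups on 25 vertices -/

theorem five_parts {V : Type} [Fintype V] (P : V → Fin 5) :
    Nat.card {w // P w = 0} + Nat.card {w // P w = 1} + Nat.card {w // P w = 2} +
      Nat.card {w // P w = 3} + Nat.card {w // P w = 4} = Fintype.card V := by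
  classical
  have h := Fintype.card_congr (Equiv.sigmaFiberEquiv P)
  rw [Fintype.card_sigma, Fin.sum_univ_five] at h
  simp only [Nat.card_eq_fintype_card]
  exact h

def LexM (c A : ℕ) : Prop := ∀ a < 5, ∀ b < 5, ∀ a' < 5, ∀ b' < 5,
  mbit 25 A (5 * a + b) (5 * a' + b') =
    if a = a' then (if b = b' then 0 else bit c (ix b b')) else bit c (ix a a')

instance (c A : ℕ) : Decidable (LexM c A) := by unfold LexM; infer_instance

theorem iter25 {c A : ℕ} (hA : SymM 25 A) (hL : LexM c A) (G : SimpleGraph (Fin 25))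
    (h : IsIterBalancedBlowupOf (gr c) G) : Nonempty (G ≃g matG 25 A) := by
  obtain ⟨k, hk⟩ := h
  cases k with
  | zero => simp [iterAux] at hk
  | succ k =>
  rcases hk with hk | ⟨P, hs, ha, hb, hi⟩
  · simp at hk
  have hsum := five_parts P
  rw [Fintype.card_fin] at hsum
  have hsz : ∀ u, Nat.card {w // P w = u} = 5 := by
    have b1 := hb 0 1
    have b2 := hb 0 2
    have b3 := hb 0 3
    have b4 := hb 0 4
    have b5 := hb 1 0
    have b6 := hb 2 0
    have b7 := hb 3 0
    have b8 := hb 4 0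
    have c1 := hb 1 2
    have c2 := hb 1 3
    have c3 := hb 1 4
    have c4 := hb 2 1
    have c5 := hb 2 3
    have c6 := hb 2 4
    have c7 := hb 3 1
    have c8 := hb 3 2
    have c9 := hb 3 4
    have d1 := hb 4 1
    have d2 := hb 4 2
    have d3 := hb 4 3
    intro u
    fin_cases u <;> simp only [Fin.zero_eta, Fin.mk_one, Fin.reduceFinMk] <;> omega
  have hQ : ∀ u : Fin 5, ∃ Q : {w : Fin 25 // P w = u} → Fin 5, Function.Injective Q ∧
      ∀ w w', Q w ≠ Q w' → (G.Adj w.1 w'.1 ↔ (gr c).Adj (Q w) (Q w')) := by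
    intro u
    have h := hi u
    have h5 : Nat.card ↥{w : Fin 25 | P w = u} = 5 := hsz u
    cases k with
    | zero =>
      simp only [iterAux, Fintype.card_fin] at h
      omega
    | succ k =>
      rcases h with h | ⟨Q, hQs, hQa, -, -⟩
      · simp only [Fintype.card_fin] at h
        omega
      · refine ⟨Q, ?_, fun w w' hne => hQa w w' hne⟩
        exact ((Nat.bijective_iff_surjective_and_card Q).2 ⟨hQs, by rw [h5]; simp⟩).1
  choose Q hQi hQa using hQ
  have hlt : ∀ w, 5 * (P w : ℕ) + (Q (P w) ⟨w, rfl⟩ : ℕ) < 25 := by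
    intro w
    have := (P w).2
    have := (Q (P w) ⟨w, rfl⟩).2
    omega
  let F : Fin 25 → Fin 25 := fun w => ⟨5 * (P w : ℕ) + (Q (P w) ⟨w, rfl⟩ : ℕ), hlt w⟩
  have hQeq : ∀ w u (h : P w = u), (Q (P w) ⟨w, rfl⟩) = Q u ⟨w, h⟩ := by
    intro w u h; subst h; rfl
  have hF : Function.Injective F := by
    intro w w' h
    have h1 := congrArg Fin.val h
    simp only [F] at h1
    have a1 := (Q (P w) ⟨w, rfl⟩).2
    have a2 := (Q (P w') ⟨w', rfl⟩).2
    have e1 : P w' = P w := Fin.ext (by omega)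
    have e2 : Q (P w) ⟨w, rfl⟩ = Q (P w') ⟨w', rfl⟩ := Fin.ext (by omega)
    rw [hQeq w' _ e1] at e2
    exact congrArg Subtype.val (hQi _ e2)
  refine ⟨⟨Equiv.ofBijective F (Finite.injective_iff_bijective.1 hF), ?_⟩⟩
  intro w w'
  show (matG 25 A).Adj (F w) (F w') ↔ G.Adj w w'
  by_cases hww : w = w'
  · subst hww; simp
  rw [matG_adj hA (fun h => hww (hF h))]
  simp only [F]
  rw [hL _ (P w).2 _ (Q (P w) ⟨w, rfl⟩).2 _ (P w').2 _ (Q (P w') ⟨w', rfl⟩).2]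
  by_cases hP : P w' = P w
  · rw [if_pos (congrArg Fin.val hP.symm)]
    rw [hQeq w' _ hP]
    have hne : Q (P w) ⟨w, rfl⟩ ≠ Q (P w) ⟨w', hP⟩ :=
      fun h => hww (congrArg Subtype.val (hQi _ h))
    rw [if_neg (fun h => hne (Fin.ext h)), hQa _ _ _ hne]
    show _ ↔ (_ ∧ _)
    simp [hne]
  · have hP' : P w ≠ P w' := fun h => hP h.symm
    rw [if_neg (fun h => hP' (Fin.ext h)), ha w w' hP']
    show _ ↔ (_ ∧ _)
    simp [hP']

/-- The finite verification for the graph with code `c`: flipping the pair `x, y` in the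
lexicographic square (bit matrix `A`) gives the matrix `A'`, which has more copies. -/
def Check (c A A' mask x y : ℕ) (r : List ℕ) : Prop :=
  maskL c perms5 = mask ∧ SymM 25 A ∧ SymM 25 A' ∧ LexM c A ∧
  (∀ a < 25, ∀ b < 25, a = x ∧ b = y ∨ a = y ∧ b = x ∨ mbit 25 A a b = mbit 25 A' a b) ∧
  (x < 25 ∧ y < 25 ∧ x ≠ y) ∧
  ((List.finRange 25).filter (fun z : Fin 25 => (z : ℕ) ≠ x ∧ (z : ℕ) ≠ y)).map Fin.val = r ∧
  cnt (pA 25 A mask) r 3 [y, x] < cnt (pA 25 A' mask) r 3 [y, x]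

instance (c A A' mask x y : ℕ) (r : List ℕ) : Decidable (Check c A A' mask x y r) := by
  unfold Check; infer_instance

theorem not_frac {c A A' mask x y : ℕ} {r : List ℕ} (h : Check c A A' mask x y r) :
    ¬ IsFractalizer (gr c) := by
  obtain ⟨hm, hA, hA', hL, hf, ⟨hx, hy, hxy⟩, hr, hlt⟩ := h
  intro hfr
  obtain ⟨G, hG⟩ := exists_max 25 (gr c)
  obtain ⟨e⟩ := iter25 hA hL G (hfr 25 G hG)
  have h1 := hG (matG 25 A')
  rw [copies_iso_right _ e] at h1
  subst hm
  subst hr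
  have := flip_lt (c := c) hA hA' ⟨x, hx⟩ ⟨y, hy⟩
    ((List.finRange 25).filter (fun z : Fin 25 => (z : ℕ) ≠ x ∧ (z : ℕ) ≠ y)) (by
      simp only [List.nodup_cons, List.mem_cons, List.mem_filter, List.mem_finRange]
      refine ⟨by simpa using hxy, by simp, (List.nodup_finRange 25).filter _⟩) (by
      intro z
      simp only [List.mem_cons, List.mem_filter, List.mem_finRange, Fin.ext_iff]
      by_cases h1 : (z : ℕ) = x <;> by_cases h2 : (z : ℕ) = y <;> simp [h1, h2]) hf hlt
  omega

end Fz
namespace Fz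

/-! ### The finite verifications -/

theorem chk1 : Check 1
    115172200005103487530559500778661934668542078667012974564489090551926413076649753409701384879694793881562786831185340314330045688142759693320817603906643990857909218
    115172200005103487530559500778661934668542078667012974564489090831894522536273997861491688661857408096394369319145613088178448519879304701932543437770627704200102882
    13407807929942597099574024998205846127479365820592393377723561443721764030073662768891111614362326998675040546094339661120786444314449509351793071908520214
    12 13 [0, 1, 2, 3, 4, 5, 6, 7, 8, 9, 10, 11, 14, 15, 16, 17, 18, 19, 20, 21, 22, 23, 24] := by
  decide +kernel

theorem chk3 : Check 3
    3864537638189472079394159682710918086765299374801727929043931985024076138413238555040699106209802892180783038729403617445901962624640952083104249633600234937126190938357734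
    3864537638189472079394159682710918086765299374801727929043931985024076138413238555040699106209802892180783038729403617445901962624640952083104249633600234937126190904803300
    1552518092300708935148979488462502555261448457734318806357940540033281935524027269599629939217333435067240778246490553652095021253535918099795276658862031210425188516841609960642123005224047111504868873191725312640756294279563970152
    0 1 [2, 3, 4, 5, 6, 7, 8, 9, 10, 11, 12, 13, 14, 15, 16, 17, 18, 19, 20, 21, 22, 23, 24] := by
  decide +kernel

theorem chk7 : Check 7
    11593613144912761330008173064374035962413374810343602925327689594632141426448873860776938354947675643607408270762940645278950135367589070147723487681882571619737946747338726
    11593613144912761330008173064374035962413374810343602925327689594632141426448873860776938354947675643607408270762940645278950135367589070147733628887288860364757234960334822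
    6668014432879854274079851790721257797144758621320016476884443660695176171769039100443544297294207581829884389010240829651770776497502199514554974949623974914317665466061123188939060206338936551759307638378094160116413281072539252856625037440
    3 4 [0, 1, 2, 5, 6, 7, 8, 9, 10, 11, 12, 13, 14, 15, 16, 17, 18, 19, 20, 21, 22, 23, 24] := by
  decide +kernel

theorem chk11 : Check 11
    129672365392068668143012284325148994143206225577964700115842373248223743592126577649831157520570907635476642843841895857323859063423722403700740776326192448018546733528762201145326
    129672365392068668143012284325148994143206225577964700115842373248223743592126577649831157520570907635476642843841895857323859063423676731771851926674631075159817352824943807561710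
    528294531135665246380978688834991567723266109969796360618766610373269329062282165014854401951658897494653554731322919774069374077287618977888637186825892982047653836690540131282385617278915284763645116437910274083648818480876665480535670666481106184876342423569670604800
    5 6 [0, 1, 2, 3, 4, 7, 8, 9, 10, 11, 12, 13, 14, 15, 16, 17, 18, 19, 20, 21, 22, 23, 24] := by
  decide +kernel

theorem chk12 : Check 12
    129672369256606536676829455545002693095406014460740760855989440488049368176115727272227908216111050163546502089684089161457269450569932522007906757841180862700648479014327071768584
    4351082566827325329071643264962196921367764793545715181983258381865301932830616191910102198458150869777772799114813903127099975831138798766307156538259617332302461621832612490963909050376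
    294971774458737136190628549960528614804546048053032654309918351761878808669236458208921216321370304796842314550902464294192058419189601749950986055993004032
    20 24 [0, 1, 2, 3, 4, 5, 6, 7, 8, 9, 10, 11, 12, 13, 14, 15, 16, 17, 18, 19, 21, 22, 23] := by
  decide +kernel

theorem chk13 : Check 13
    129672369256606651849029460648490223654906793122675429398068107501023932665206279198640984865864459864931381784477970724244100635910246852053594900600874183518252385658317929677802
    129672369256606651849029460648490222094032517964679313707269492604440779790907207866155409436285980052245512374595160664091049104164261272140128675283564843336328094110645136360426
    102174320690494256440024638094694237762100675296583014707467002176856394015231561927712720572339902416610342870500247529749944717935562110395929187092909218477517165236246934061697663786244947933620694629502367384195655744293199141167104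
    4 19 [0, 1, 2, 3, 5, 6, 7, 8, 9, 10, 11, 12, 13, 14, 15, 16, 17, 18, 20, 21, 22, 23, 24] := by
  decide +kernel

theorem chk15 : Check 15
    129672373121144174866301534939162375806324101226040135657717369531981353200191865685466463256810156373349394270467127890860886896471895146648858840945430496300883416140518010126318
    129672373121144174866301534939187949171972581118733594283953130672717990201405384815982431915378855152825881834772742120156551237086107137911489647711814333703316102648399622307822
    2269042364646440977538314721042945428942643413943184544973746037776086021453411457351088927993593393037055937831307563761511710201600673754632159575807747443424489567920938895003162491721598078583176864114043292810098836250548644463719691233576666640314361037454868585991748222976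
    18 19 [0, 1, 2, 3, 4, 5, 6, 7, 8, 9, 10, 11, 12, 13, 14, 15, 16, 17, 20, 21, 22, 23, 24] := by
  decide +kernel

theorem chk30 : Check 30
    389017096176207040978672143762991713557786066470787348689709748359784315821260508934080587324736800100552873178617388280127430348414162353397621526303054431323336639152138319035404
    389017096176207040978672143762991713557786066470787348689709748359784315821260508934080587324736800100552873178617388280127430348414162353397621526303054431323336638026238412192776
    1629522989678824098332368871090242995526161781605196954527063013721458560185807643631491313941064265800349321552323202762066686687607263686651349709419263223266736007997388111729221311466125126952115287821524932803149850786704118387834880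
    0 2 [1, 3, 4, 5, 6, 7, 8, 9, 10, 11, 12, 13, 14, 15, 16, 17, 18, 19, 20, 21, 22, 23, 24] := by
  decide +kernel

theorem chk31 : Check 31
    389017096176207156150872148866479244117286845132722017231788415372758880310351060860493663974490209801937752873411269842914261533754476683443309669062747752140940545796129176944622
    389017096176207156150872148866479244117286845132722017231788415372758880310351060860493663974490209801937752873411269842914261533754476683443309669062747752140940545796129143390188
    148737995525477405935506145317367177787230073603235032744835274185167273263719545266338130954925098491501215163351317418990175777303796996309923000873453230251433650886792006380371336996207356080061372154828354249134089343949918807544837123442095057444308776386657505663780263269761024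
    0 1 [2, 3, 4, 5, 6, 7, 8, 9, 10, 11, 12, 13, 14, 15, 16, 17, 18, 19, 20, 21, 22, 23, 24] := by
  decide +kernel

theorem chk63 : Check 63
    907706573202631460102989889390692612224776655939142650605920746726653865411513644804921367845461377892385913793006975434372209098123057784387192830782083070971577201746482679513070
    907706573202631460102989889390692612224776655939142650605920746726653865411513644804921367845461377892385913793006975434372209098123057784387192830783350721571805431147979382718462
    2379227053564452900477025952271301387687589798441458755521596684342370117642882824209723505110509269183147594593702519518338812777802072910269269383507510415614308140247253364739336333777427092878412749233957411881955074277632326940912487365925727304562865662240801223086456963625648128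
    0 4 [1, 2, 3, 5, 6, 7, 8, 9, 10, 11, 12, 13, 14, 15, 16, 17, 18, 19, 20, 21, 22, 23, 24] := by
  decide +kernel

theorem chk76 : Check 76
    4351211201813794261190441088884032258123088832261790622738781156004453331256547138351431398813308746189345794169450548376938569075737094424194651932392406272637680093738202675403588337688
    4351211201813794261190441088884032258123088832261790622738781156004453331256547138351431398813308746189345794169450548376938569075737094424194651932392406272637680093738200423603640434712
    3105036184601417870297958976925005110532021796703882003156626048898587918981524228147096444094912702815916896725324690955107245061085063946074665645674739198064421599153913490353814472921403955762929965764909482955397441890124038144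
    1 2 [0, 3, 4, 5, 6, 7, 8, 9, 10, 11, 12, 13, 14, 15, 16, 17, 18, 19, 20, 21, 22, 23, 24] := by
  decide +kernel

theorem chk77 : Check 77
    4351211201813794261190556261084037361610619391762569284673449698083120344231111627441983325226385395942755495554330243170820131862568279764508981978080549032331000911342109319394446246906
    4351211201813794261190556261084037361610619391762569284673449698083120344231111627441983325226385395880590087297760057307279097289944154473938911823772575051774954537054483939607625827322
    138413167157544296421707731119834983749437701004422566188357585544971510067079722645162377422991645206761626113512937106256422481998514841714272100643950749258185332554284191939293513226483181524711705006017414958448527528474148741552521901103175870331074840366655366758400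
    10 11 [0, 1, 2, 3, 4, 5, 6, 7, 8, 9, 12, 13, 14, 15, 16, 17, 18, 19, 20, 21, 22, 23, 24] := by
  decide +kernel

theorem chk86 : Check 86
    4351211331486159653259915437186515545122797862353703820120043675610316998699736215445773824073385374943294305502070974251380559825656374746664704262318481512568434298114566410643572816916
    4351211331486160136327105814343808632041784228852122220905322036718137105516046590887933787089118785626545268987492809878976620462390185012824893774474718861692821614588626765066988977172
    617691058275129259774113575197645234217948842282022580801504564710676964807336227923444783059134021434412666210806971893787989702483174905401664900686243456927029254085721648041679444294567150993452606438489936312449116584114246452772864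
    17 22 [0, 1, 2, 3, 4, 5, 6, 7, 8, 9, 10, 11, 12, 13, 14, 15, 16, 18, 19, 20, 21, 23, 24] := by
  decide +kernel

theorem chk87 : Check 87
    4351211331486159653260030609386520648610328421854482482054712217688984011674300704536325750486462024696704006886950669045262122612487560086979034308006624272261755115718473054634430726134
    4351211331486159653260030609386520648610328421854482482054712217688984011674300704536325750486462024696704006886950669045262109756983206015056829972309885542960925266687965875258350665718
    589950943416464902641825618438198113036988461176878851662675555282792120260488891780305538743484540937970090801304046225689380405336252092538560121321391072349413718192428381582919757221949749548550566390277945402721945394331334943109029044054459112957888321579800523900873166815232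
    3 8 [0, 1, 2, 4, 5, 6, 7, 9, 10, 11, 12, 13, 14, 15, 16, 17, 18, 19, 20, 21, 22, 23, 24] := by
  decide +kernel

theorem chk94 : Check 94
    4351211461158521180790945390726720476112109294641842632785368989724761202991494783496213060665987854815095731175821637310237687745897992268424483322107174734511248716426362813214835604508
    4351211461158521180790945390726720476112109294641842632785368989724761202991494783496213060665987854815095731175821637310237687745897992268424483322107174734511248716426361687314928761880
    815686756073467174152754802457644404828694151407063194253677317373456159439606002122185897298314732626903528701816306638594367543138477078903918369405529534914032098806921323450462887924352862700249877428499591597728502866584837863984789049052794278061897622605713570267136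
    0 2 [1, 3, 4, 5, 6, 7, 8, 9, 10, 11, 12, 13, 14, 15, 16, 17, 18, 19, 20, 21, 22, 23, 24] := by
  decide +kernel

theorem chk116 : Check 116
    4351211850175632815146696372032181778664013818426206523175970790093386321637300781622771281675610854968765887532219407857928984666817678553597510610937702887347440346120191878796994936848
    4351211850175632815146696372032181778664013818426206523175970790093386321637300781622771281675610854968765887532219407857928984666817678553597510610937702887347440346120191878797028491282
    13336028865759708548159703581442515594289517840648249586745259020012429204766269387366892731421110566050346714492789958235783438713170032317851510605278264793893856469275937403137590290537564064383939696832527177233927921424275490469905956864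
    0 1 [2, 3, 4, 5, 6, 7, 8, 9, 10, 11, 12, 13, 14, 15, 16, 17, 18, 19, 20, 21, 22, 23, 24] := by
  decide +kernel

/-- Codes of the representatives with their masks. -/
def reps : List (ℕ × ℕ) := [
  (1, 13407807929942597099574024998205846127479365820592393377723561443721764030073662768891111614362326998675040546094339661120786444314449509351793071908520214),
  (3, 1552518092300708935148979488462502555261448457734318806357940540033281935524027269599629939217333435067240778246490553652095021253535918099795276658862031210425188516841609960642123005224047111504868873191725312640756294279563970152),
  (7, 6668014432879854274079851790721257797144758621320016476884443660695176171769039100443544297294207581829884389010240829651770776497502199514554974949623974914317665466061123188939060206338936551759307638378094160116413281072539252856625037440),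
  (11, 528294531135665246380978688834991567723266109969796360618766610373269329062282165014854401951658897494653554731322919774069374077287618977888637186825892982047653836690540131282385617278915284763645116437910274083648818480876665480535670666481106184876342423569670604800),
  (12, 294971774458737136190628549960528614804546048053032654309918351761878808669236458208921216321370304796842314550902464294192058419189601749950986055993004032),
  (13, 102174320690494256440024638094694237762100675296583014707467002176856394015231561927712720572339902416610342870500247529749944717935562110395929187092909218477517165236246934061697663786244947933620694629502367384195655744293199141167104),
  (15, 2269042364646440977538314721042945428942643413943184544973746037776086021453411457351088927993593393037055937831307563761511710201600673754632159575807747443424489567920938895003162491721598078583176864114043292810098836250548644463719691233576666640314361037454868585991748222976),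
  (30, 1629522989678824098332368871090242995526161781605196954527063013721458560185807643631491313941064265800349321552323202762066686687607263686651349709419263223266736007997388111729221311466125126952115287821524932803149850786704118387834880),
  (31, 148737995525477405935506145317367177787230073603235032744835274185167273263719545266338130954925098491501215163351317418990175777303796996309923000873453230251433650886792006380371336996207356080061372154828354249134089343949918807544837123442095057444308776386657505663780263269761024),
  (63, 2379227053564452900477025952271301387687589798441458755521596684342370117642882824209723505110509269183147594593702519518338812777802072910269269383507510415614308140247253364739336333777427092878412749233957411881955074277632326940912487365925727304562865662240801223086456963625648128),
  (76, 3105036184601417870297958976925005110532021796703882003156626048898587918981524228147096444094912702815916896725324690955107245061085063946074665645674739198064421599153913490353814472921403955762929965764909482955397441890124038144),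
  (77, 138413167157544296421707731119834983749437701004422566188357585544971510067079722645162377422991645206761626113512937106256422481998514841714272100643950749258185332554284191939293513226483181524711705006017414958448527528474148741552521901103175870331074840366655366758400),
  (86, 617691058275129259774113575197645234217948842282022580801504564710676964807336227923444783059134021434412666210806971893787989702483174905401664900686243456927029254085721648041679444294567150993452606438489936312449116584114246452772864),
  (87, 589950943416464902641825618438198113036988461176878851662675555282792120260488891780305538743484540937970090801304046225689380405336252092538560121321391072349413718192428381582919757221949749548550566390277945402721945394331334943109029044054459112957888321579800523900873166815232),
  (94, 815686756073467174152754802457644404828694151407063194253677317373456159439606002122185897298314732626903528701816306638594367543138477078903918369405529534914032098806921323450462887924352862700249877428499591597728502866584837863984789049052794278061897622605713570267136),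
  (116, 13336028865759708548159703581442515594289517840648249586745259020012429204766269387366892731421110566050346714492789958235783438713170032317851510605278264793893856469275937403137590290537564064383939696832527177233927921424275490469905956864),
  (236, 826684833788281493788128598016513517387527358456335749870866410181481313944199380312954594389990551879644384771628091815701758557693979073813277318530457690142995864282119946084594837243973964541577994953414521552493775272982407788101632)]

end Fz
namespace Fz
open Finset

/-! ### The five-cycle: a tie at eight vertices -/

theorem c5_mask : maskL 236 perms5 =
    826684833788281493788128598016513517387527358456335749870866410181481313944199380312954594389990551879644384771628091815701758557693979073813277318530457690142995864282119946084594837243973964541577994953414521552493775272982407788101632 := by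
  decide +kernel

theorem c5_sym : SymM 8 5586463750142194920 := by decide +kernel

theorem c5_count : inducedCopies (gr 236) (matG 8 5586463750142194920) = 8 := by
  rw [copies_eq_cnt c5_sym (List.finRange 8) (List.nodup_finRange 8) (List.mem_finRange),
    c5_mask]
  decide +kernel

theorem c5_notwin : ∀ a < 8, ∀ b < 8, a ≠ b → ∃ w < 8, w ≠ a ∧ w ≠ b ∧
    mbit 8 5586463750142194920 a w ≠ mbit 8 5586463750142194920 b w := by
  decide +kernel

theorem c5_prime : ∀ i j : Fin 5, i ≠ j → ∃ k : Fin 5, k ≠ i ∧ k ≠ j ∧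
    bit 236 (ix i k) ≠ bit 236 (ix j k) := by
  decide +kernel

/-- In a balanced blow-up of `C₅` on eight vertices, vertices in the same part are twins. -/
theorem parts8 (P : Fin 8 → Fin 5)
    (hb : ∀ u v : Fin 5, Nat.card {w // P w = u} ≤ Nat.card {w // P w = v} + 1) :
    (∀ u, Nat.card {w // P w = u} ≤ 2) ∧
      Nat.card {w // P w = 0} * Nat.card {w // P w = 1} * Nat.card {w // P w = 2} *
      Nat.card {w // P w = 3} * Nat.card {w // P w = 4} = 8 := by
  have hsum := five_parts P
  rw [Fintype.card_fin] at hsum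
  have hge : ∀ u, 1 ≤ Nat.card {w // P w = u} ∧ Nat.card {w // P w = u} ≤ 2 := by
    intro u
    have b0 := hb u 0
    have b1 := hb u 1
    have b2 := hb u 2
    have b3 := hb u 3
    have b4 := hb u 4
    have c0 := hb 0 u
    have c1 := hb 1 u
    have c2 := hb 2 u
    have c3 := hb 3 u
    have c4 := hb 4 u
    fin_cases u <;> simp only [Fin.zero_eta, Fin.mk_one, Fin.reduceFinMk] at * <;> omega
  refine ⟨fun u => (hge u).2, ?_⟩
  have h0 := hge 0
  have h1 := hge 1
  have h2 := hge 2
  have h3 := hge 3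
  have h4 := hge 4
  generalize Nat.card {w // P w = 0} = a at *
  generalize Nat.card {w // P w = 1} = b at *
  generalize Nat.card {w // P w = 2} = c at *
  generalize Nat.card {w // P w = 3} = d at *
  generalize Nat.card {w // P w = 4} = e at *
  clear hb hge
  obtain ⟨a1, a2⟩ := h0
  obtain ⟨b1, b2⟩ := h1
  obtain ⟨c1, c2⟩ := h2
  obtain ⟨d1, d2⟩ := h3
  obtain ⟨e1, e2⟩ := h4
  interval_cases a <;> interval_cases b <;> interval_cases c <;> interval_cases d <;>
    interval_cases e <;> first | rfl | (exfalso; omega)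

theorem part_pair {P : Fin 8 → Fin 5} (h : ∀ u, Nat.card {w // P w = u} ≤ 2)
    {a b w : Fin 8} (hab : a ≠ b) (hP : P a = P b) (hwa : w ≠ a) (hwb : w ≠ b) : P w ≠ P a := by
  classical
  intro hw
  have h2 := h (P a)
  rw [Nat.card_eq_fintype_card, Fintype.card_subtype] at h2
  have : ({a, b, w} : Finset (Fin 8)).card = 3 := by
    rw [Finset.card_eq_three]
    exact ⟨a, b, w, hab, hwa.symm, hwb.symm, rfl⟩
  have hsub : ({a, b, w} : Finset (Fin 8)) ⊆ univ.filter (fun x => P x = P a) := by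
    intro x hx
    simp only [mem_insert, mem_singleton] at hx
    rcases hx with rfl | rfl | rfl <;> simp [hP, hw]
  have := Finset.card_le_card hsub
  omega

theorem iter8 (G : SimpleGraph (Fin 8)) (h : IsIterBalancedBlowupOf (gr 236) G) :
    ∃ P : Fin 8 → Fin 5,
      (∀ w w', P w ≠ P w' → (G.Adj w w' ↔ (gr 236).Adj (P w) (P w'))) ∧
      (∀ u v : Fin 5, Nat.card {w // P w = u} ≤ Nat.card {w // P w = v} + 1) := by
  obtain ⟨k, hk⟩ := h
  cases k with
  | zero => simp [iterAux] at hk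
  | succ k =>
  rcases hk with hk | ⟨P, hs, ha, hb, hi⟩
  · simp at hk
  · exact ⟨P, ha, hb⟩

theorem c5_upper (G : SimpleGraph (Fin 8)) (h : IsIterBalancedBlowupOf (gr 236) G) :
    inducedCopies (gr 236) G ≤ 8 := by
  classical
  obtain ⟨P, ha, hb⟩ := iter8 G h
  obtain ⟨h2, hprod⟩ := parts8 P hb
  have hpi : (Fintype.piFinset (fun u : Fin 5 => univ.filter (fun w => P w = u))).card = 8 := by
    rw [Fintype.card_piFinset, Fin.prod_univ_five]
    refine Eq.trans ?_ hprod
    simp only [Nat.card_eq_fintype_card, Fintype.card_subtype]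
  rw [copies_eq_card, Fintype.card_fin]
  refine le_trans ?_ (le_of_eq hpi)
  refine le_trans (Finset.card_le_card (t := (Fintype.piFinset (fun u : Fin 5 =>
    univ.filter (fun w => P w = u))).image (fun f => univ.image f)) ?_) Finset.card_image_le
  intro s hs
  rw [mem_filter, mem_powersetCard] at hs
  obtain ⟨⟨-, hs5⟩, ⟨e⟩⟩ := hs
  have hinj : Set.InjOn P s := by
    intro a has b hbs hP
    by_contra hab
    obtain ⟨k, hki, hkj, hk⟩ := c5_prime (e ⟨a, has⟩) (e ⟨b, hbs⟩)
      (fun h => hab (congrArg Subtype.val (e.injective h)))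
    obtain ⟨⟨w, hw⟩, rfl⟩ := e.surjective k
    have hwa : w ≠ a := by rintro rfl; exact hki rfl
    have hwb : w ≠ b := by rintro rfl; exact hkj rfl
    have hPw := part_pair h2 hab hP hwa hwb
    have k1 := ha a w hPw.symm
    have k2 := ha b w (hP ▸ hPw.symm)
    rw [← hP] at k2
    have m1 := e.map_rel_iff (a := ⟨a, has⟩) (b := ⟨w, hw⟩)
    have m2 := e.map_rel_iff (a := ⟨b, hbs⟩) (b := ⟨w, hw⟩)
    change (_ ∧ _) ↔ G.Adj a w at m1
    change (_ ∧ _) ↔ G.Adj b w at m2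
    rw [k1, ← k2, ← m2] at m1
    simp only [ne_eq, hki.symm, hkj.symm, not_false_eq_true, true_and] at m1
    have l1 := bit_lt 236 (ix (e ⟨a, has⟩) (e ⟨w, hw⟩))
    have l2 := bit_lt 236 (ix (e ⟨b, hbs⟩) (e ⟨w, hw⟩))
    have m3 : bit 236 (ix (e ⟨a, has⟩) (e ⟨w, hw⟩)) = 1 ↔
      bit 236 (ix (e ⟨b, hbs⟩) (e ⟨w, hw⟩)) = 1 := m1
    omega
  have himg : s.image P = univ := by
    apply Finset.eq_univ_of_card
    rw [Finset.card_image_of_injOn hinj, hs5, Fintype.card_fin]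
  have hex : ∀ u, ∃ w ∈ s, P w = u := by
    intro u
    have : u ∈ s.image P := by rw [himg]; simp
    simpa using this
  choose f hf hfP using hex
  rw [mem_image]
  refine ⟨f, by simpa using hfP, ?_⟩
  apply Finset.eq_of_subset_of_card_le
  · intro w hw
    simp only [mem_image, mem_univ, true_and] at hw
    obtain ⟨u, rfl⟩ := hw
    exact hf u
  · rw [hs5, Finset.card_image_of_injective]
    · simp
    · intro u v huv
      rw [← hfP u, huv, hfP v]

theorem not_frac_c5 : ¬ IsFractalizer (gr 236) := by
  intro hfr
  obtain ⟨G, hG⟩ := exists_max 8 (gr 236)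
  have h1 := c5_upper G (hfr 8 G hG)
  obtain ⟨P, ha, hb⟩ := iter8 _ (hfr 8 (matG 8 5586463750142194920) (fun G' => by
    rw [c5_count]; exact (hG G').trans h1))
  obtain ⟨h2, -⟩ := parts8 P hb
  obtain ⟨a, b, hab, hP⟩ := Fintype.exists_ne_map_eq_of_card_lt P (by simp)
  obtain ⟨w, hw8, hwa, hwb, hne⟩ := c5_notwin a a.2 b b.2 (fun h => hab (Fin.ext h))
  have hwa' : (⟨w, hw8⟩ : Fin 8) ≠ a := fun h => hwa (congrArg Fin.val h)
  have hwb' : (⟨w, hw8⟩ : Fin 8) ≠ b := fun h => hwb (congrArg Fin.val h)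
  have hPw := part_pair h2 hab hP hwa' hwb'
  have k1 := ha a ⟨w, hw8⟩ hPw.symm
  have k2 := ha b ⟨w, hw8⟩ (hP ▸ hPw.symm)
  rw [← hP, ← k1, matG_adj c5_sym hwa'.symm, matG_adj c5_sym hwb'.symm] at k2
  have l1 : mbit 8 5586463750142194920 a w < 2 := bit_lt _ _
  have l2 : mbit 8 5586463750142194920 b w < 2 := bit_lt _ _
  simp only at k2
  omega

/-! ### Conclusion -/

theorem cover : ∀ d < 1024, d = 0 ∨ d = 1023 ∨
    ∃ r ∈ reps, bit r.2 d = 1 ∨ bit r.2 (1023 - d) = 1 := by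
  decide +kernel

theorem reps_mask : ∀ r ∈ reps, maskL r.1 perms5 = r.2 := by
  decide +kernel

theorem reps_not : ∀ r ∈ reps, ¬ IsFractalizer (gr r.1) := by
  intro r hr
  simp only [reps, List.mem_cons, List.not_mem_nil, or_false] at hr
  rcases hr with rfl | rfl | rfl | rfl | rfl | rfl | rfl | rfl | rfl | rfl | rfl | rfl | rfl | rfl | rfl | rfl | rfl
  · exact not_frac chk1
  · exact not_frac chk3
  · exact not_frac chk7
  · exact not_frac chk11
  · exact not_frac chk12
  · exact not_frac chk13
  · exact not_frac chk15
  · exact not_frac chk30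
  · exact not_frac chk31
  · exact not_frac chk63
  · exact not_frac chk76
  · exact not_frac chk77
  · exact not_frac chk86
  · exact not_frac chk87
  · exact not_frac chk94
  · exact not_frac chk116
  · exact not_frac_c5

theorem gr_zero : gr 0 = ⊥ := by
  ext i j
  simp only [SimpleGraph.bot_adj, iff_false]
  rintro ⟨-, h⟩
  rw [bit_eq_one] at h
  simp at h

theorem gr_top : gr 1023 = ⊤ := by
  have := gr_compl 0 (by norm_num)
  rw [gr_zero, compl_bot] at this
  exact this

end Fz

/-- A graph on 5 vertices is a fractalizer iff it is the complete graph `K5` or the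
empty graph on 5 vertices. -/
theorem fractalizer_five_vertices (H : SimpleGraph (Fin 5)) :
    IsFractalizer H ↔ H = ⊤ ∨ H = ⊥ := by
  constructor
  · intro h
    obtain ⟨d, hd, rfl⟩ := Fz.gr_surj H
    rcases Fz.cover d hd with rfl | rfl | ⟨r, hr, hm⟩
    · exact Or.inr Fz.gr_zero
    · exact Or.inl Fz.gr_top
    · exfalso
      rw [← Fz.reps_mask r hr] at hm
      rcases hm with hm | hm
      · obtain ⟨e⟩ := (Fz.gr_iso_iff r.1 d hd).1 hm
        exact Fz.reps_not r hr (Fz.frac_iso e h)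
      · obtain ⟨e⟩ := (Fz.gr_iso_iff r.1 (1023 - d) (by omega)).1 hm
        rw [Fz.gr_compl d hd] at e
        exact Fz.reps_not r hr (Fz.frac_iso e (Fz.frac_compl h))
  · rintro (rfl | rfl)
    · exact Fz.frac_top
    · have := Fz.frac_compl Fz.frac_top
      rwa [compl_top] at this
end
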